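/- arXiv:2411.19676 — 2 statements merged into one kernel-verified Lean document; each statement's English description precedes it below -/
import Mathlib

section
/- Let n ≥ 1, m ≥ 1, 0 < κ < 1, 1 < p_1,…,p_m < ∞, and 1/p = 1/p_1 + ⋯ + 1/p_m. Then there exists a constant C > 0 such that for all measurable f_1,…,f_m on ℝⁿ with ‖f_i‖_{L^{p_i,κ}} < ∞, ‖M(f⃗)‖_{L^{p,κ}} ≤ C ∏_{i=1}^m ‖f_i‖_{L^{p_i,κ}}. -/
open MeasureTheory Metric ENNReal

noncomputable section

/-- Euclidean space `ℝⁿ`. -/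
abbrev Euc (n : ℕ) := EuclideanSpace ℝ (Fin n)

/-- `Ω` is homogeneous of degree zero. -/
def HomogZero {n : ℕ} (Ω : Euc n → ℝ) : Prop :=
  ∀ ⦃l : ℝ⦄, 0 < l → ∀ x, Ω (l • x) = Ω x

/-- The `L^s` norm of `Ω` on the unit sphere `S^{n-1}`, where the surface measure
`volume.toSphere` is normalized so that the polar coordinate formula
`∫_{ℝⁿ} g(y) dy = ∫_0^∞ ∫_{S^{n-1}} g(ρθ) ρ^{n-1} dσ(θ) dρ` holds. -/
noncomputable def sphereLpNorm (n : ℕ) (s : ℝ≥0∞) (Ω : Euc n → ℝ) : ℝ≥0∞ :=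
  eLpNorm (fun θ : sphere (0 : Euc n) 1 => Ω θ.1) s ((volume : Measure (Euc n)).toSphere)

/-- `Ω ∈ L^s(S^{n-1})`: measurable, homogeneous of degree zero, finite sphere `L^s` norm. -/
def MemSphereLp (n : ℕ) (s : ℝ≥0∞) (Ω : Euc n → ℝ) : Prop :=
  Measurable Ω ∧ HomogZero Ω ∧ sphereLpNorm n s Ω < ⊤

/-- The conjugate exponent `s' = s/(s-1)` (with `s' = 1` for `s = ∞`). -/
noncomputable def conjExp (s : ℝ≥0∞) : ℝ := if s = ⊤ then 1 else s.toReal / (s.toReal - 1)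

/-- The multilinear fractional integral operator with homogeneous kernels,
`T_{Ω,α;m}(f⃗)(x) = ∫_{(ℝⁿ)^m} ∏ᵢ Ωᵢ(x-yᵢ) fᵢ(yᵢ) / ‖(x-y₁,…,x-y_m)‖^{mn-α} dy⃗`. -/
noncomputable def multiT {n : ℕ} (m : ℕ) (α : ℝ) (Ω f : Fin m → Euc n → ℝ) (x : Euc n) : ℝ :=
  ∫ y : Fin m → Euc n,
    (∏ i, Ω i (x - y i) * f i (y i)) /
      (Real.sqrt (∑ j, ‖x - y j‖ ^ 2)) ^ ((m * n : ℝ) - α)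

/-- The multilinear maximal operator `𝓜(f⃗)(x)`, with values in `[0,∞]`. -/
noncomputable def multiM {n : ℕ} (m : ℕ) (f : Fin m → Euc n → ℝ) (x : Euc n) : ℝ≥0∞ :=
  ⨆ r : Set.Ioi (0 : ℝ),
    ∏ i, (volume (ball x (r : ℝ)))⁻¹ * ∫⁻ y in ball x (r : ℝ), ENNReal.ofReal |f i y|

/-- `𝓜_t(f⃗)(x) = 𝓜(|f₁|^t,…,|f_m|^t)(x)^{1/t}`, with values in `[0,∞]`. -/
noncomputable def multiMt {n : ℕ} (m : ℕ) (t : ℝ) (f : Fin m → Euc n → ℝ) (x : Euc n) : ℝ≥0∞ :=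
  (multiM m (fun i y => |f i y| ^ t) x) ^ (1 / t)

/-- The multilinear fractional maximal operator with homogeneous kernels,
`M_{Ω,α;m}(f⃗)(x) = sup_{r>0} ∏ᵢ m(B(x,r))^{α/(mn)-1} ∫_{|x-yᵢ|<r} |Ωᵢ(x-yᵢ) fᵢ(yᵢ)| dyᵢ`,
with values in `[0,∞]`. -/
noncomputable def multiMF {n : ℕ} (m : ℕ) (α : ℝ) (Ω f : Fin m → Euc n → ℝ) (x : Euc n) :
    ℝ≥0∞ :=
  ⨆ r : Set.Ioi (0 : ℝ),
    ∏ i, (volume (ball x (r : ℝ))) ^ (α / (m * n : ℝ) - 1) *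
      ∫⁻ y in ball x (r : ℝ), ENNReal.ofReal |Ω i (x - y) * f i y|

/-- Morrey norm of a `[0,∞]`-valued function:
`sup_B (m(B)^{-κ} ∫_B F^p)^{1/p}`, the supremum over all balls `B ⊆ ℝⁿ`. -/
noncomputable def morreyNormE {n : ℕ} (p κ : ℝ) (F : Euc n → ℝ≥0∞) : ℝ≥0∞ :=
  ⨆ (z : Euc n) (r : Set.Ioi (0 : ℝ)),
    (volume (ball z (r : ℝ)) ^ (-κ) * ∫⁻ y in ball z (r : ℝ), F y ^ p) ^ (1 / p)

/-- Morrey norm `‖f‖_{L^{p,κ}}`. -/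
noncomputable def morreyNorm {n : ℕ} (p κ : ℝ) (f : Euc n → ℝ) : ℝ≥0∞ :=
  morreyNormE p κ (fun x => ENNReal.ofReal |f x|)

/-- Weak Morrey norm of a `[0,∞]`-valued function:
`sup_B sup_{l>0} m(B)^{-κ/p} · l · m({y ∈ B : F y > l})^{1/p}`. -/
noncomputable def weakMorreyNormE {n : ℕ} (p κ : ℝ) (F : Euc n → ℝ≥0∞) : ℝ≥0∞ :=
  ⨆ (z : Euc n) (r : Set.Ioi (0 : ℝ)) (l : Set.Ioi (0 : ℝ)),
    volume (ball z (r : ℝ)) ^ (-(κ / p)) * ENNReal.ofReal (l : ℝ) *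
      (volume {y | y ∈ ball z (r : ℝ) ∧ ENNReal.ofReal (l : ℝ) < F y}) ^ (1 / p)

/-- Weak Morrey norm `‖f‖_{WL^{p,κ}}`. -/
noncomputable def weakMorreyNorm {n : ℕ} (p κ : ℝ) (f : Euc n → ℝ) : ℝ≥0∞ :=
  weakMorreyNormE p κ (fun x => ENNReal.ofReal |f x|)

/-- Luxemburg norm `‖f‖_{L^p log L(B)}`. -/
noncomputable def luxNorm {n : ℕ} (p : ℝ) (B : Set (Euc n)) (f : Euc n → ℝ) : ℝ :=
  sInf {l : ℝ | 0 < l ∧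
    ∫⁻ x in B, ENNReal.ofReal ((|f x| / l) ^ p * (1 + max (Real.log (|f x| / l)) 0)) ≤ 1}

/-- `‖f‖_{(L log L)^{p,κ}} = sup_B m(B)^{-κ/p} ‖f‖_{L^p log L(B)}`. -/
noncomputable def logMorreyNorm {n : ℕ} (p κ : ℝ) (f : Euc n → ℝ) : ℝ≥0∞ :=
  ⨆ (z : Euc n) (r : Set.Ioi (0 : ℝ)),
    volume (ball z (r : ℝ)) ^ (-(κ / p)) *
      ENNReal.ofReal (luxNorm p (ball z (r : ℝ)) f)

/-- Weak `L^p` norm `‖f‖_{L^{p,∞}} = sup_{l>0} l · m({|f| > l})^{1/p}`. -/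
noncomputable def weakLpNorm {n : ℕ} (p : ℝ) (f : Euc n → ℝ) : ℝ≥0∞ :=
  ⨆ l : Set.Ioi (0 : ℝ),
    ENNReal.ofReal (l : ℝ) * (volume {x | (l : ℝ) < |f x|}) ^ (1 / p)




/-- The centered Hardy–Littlewood maximal function of a `[0,∞]`-valued function. -/
def hlMax {n : ℕ} (g : Euc n → ℝ≥0∞) (x : Euc n) : ℝ≥0∞ :=
  ⨆ r : Set.Ioi (0 : ℝ), (volume (ball x (r : ℝ)))⁻¹ * ∫⁻ y in ball x (r : ℝ), g y

theorem lowerSemicontinuous_setLIntegral_ball {n : ℕ} (g : Euc n → ℝ≥0∞) (r : ℝ) :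
    LowerSemicontinuous fun x => ∫⁻ y in ball x r, g y := by
  intro x c hc
  have hU : ball x r = ⋃ k : ℕ, ball x (r - 1 / ((k : ℝ) + 1)) := by
    ext y
    simp only [mem_ball, Set.mem_iUnion]
    constructor
    · intro h
      obtain ⟨k, hk⟩ := exists_nat_one_div_lt (sub_pos.2 h)
      exact ⟨k, by linarith⟩
    · rintro ⟨k, hk⟩
      have : (0 : ℝ) < 1 / ((k : ℝ) + 1) := by positivity
      linarith
  have hmono : Monotone fun k : ℕ => ball x (r - 1 / ((k : ℝ) + 1)) := by
    intro a b hab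
    apply ball_subset_ball
    have := one_div_le_one_div_of_le (by positivity : (0 : ℝ) < (a : ℝ) + 1)
      (by gcongr : (a : ℝ) + 1 ≤ (b : ℝ) + 1)
    linarith
  have hc' : c < ⨆ k : ℕ, ∫⁻ y in ball x (r - 1 / ((k : ℝ) + 1)), g y := by
    rw [← setLIntegral_iUnion_of_directed g hmono.directed_le, ← hU]
    exact hc
  obtain ⟨k, hk⟩ := lt_iSup_iff.1 hc'
  filter_upwards [ball_mem_nhds x (by positivity : (0 : ℝ) < 1 / ((k : ℝ) + 1))] with z hz
  refine hk.trans_le (lintegral_mono_set (ball_subset_ball' ?_))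
  rw [mem_ball, dist_comm] at hz
  linarith

theorem measurable_hlMax {n : ℕ} {g : Euc n → ℝ≥0∞} (hg : Measurable g) :
    Measurable (hlMax g) := by
  refine LowerSemicontinuous.measurable (lowerSemicontinuous_iSup fun r => ?_)
  have : (fun x : Euc n => (volume (ball x (r : ℝ)))⁻¹ * ∫⁻ y in ball x (r : ℝ), g y) =
      fun x => ∫⁻ y in ball x (r : ℝ), (volume (ball (0 : Euc n) (r : ℝ)))⁻¹ * g y := by
    ext x
    rw [Measure.addHaar_ball_center, lintegral_const_mul _ hg]
  rw [this]
  exact lowerSemicontinuous_setLIntegral_ball _ _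

theorem volume_ball_mul {n : ℕ} (hn : 1 ≤ n) (x : Euc n) {c : ℝ} (hc : 0 ≤ c) (r : ℝ) :
    volume (ball x (c * r)) = ENNReal.ofReal (c ^ n) * volume (ball x r) := by
  have : Nontrivial (Euc n) := by
    have : Nonempty (Fin n) := ⟨⟨0, hn⟩⟩
    infer_instance
  rw [Measure.addHaar_ball_mul _ _ hc, Measure.addHaar_ball_center _ x r,
    finrank_euclideanSpace_fin]

theorem volume_ball_ne_zero {n : ℕ} (x : Euc n) {r : ℝ} (hr : 0 < r) :
    volume (ball x r) ≠ 0 := (measure_ball_pos _ _ hr).ne'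

theorem volume_ball_ne_top {n : ℕ} (x : Euc n) (r : ℝ) :
    volume (ball x r) ≠ ∞ := measure_ball_lt_top.ne

/-- The weak type `(1,1)` inequality for the Hardy–Littlewood maximal function. -/
theorem mul_volume_lt_hlMax_le {n : ℕ} (hn : 1 ≤ n) (g : Euc n → ℝ≥0∞) {l : ℝ≥0∞}
    (hl : l ≠ 0) :
    l * volume {x | l < hlMax g x} ≤ ENNReal.ofReal (4 ^ n) * ∫⁻ y, g y := by
  rcases eq_or_ne (∫⁻ y, g y) ∞ with hI | hI
  · rw [hI, ENNReal.mul_top (by positivity)]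
    exact le_top
  have key : ∀ x ∈ {x | l < hlMax g x}, ∃ r : ℝ, 0 < r ∧
      l * volume (ball x r) ≤ ∫⁻ y in ball x r, g y := by
    intro x hx
    rw [Set.mem_ofPred_eq, hlMax] at hx
    obtain ⟨r, hr⟩ := lt_iSup_iff.1 hx
    refine ⟨r, r.2, ?_⟩
    rw [mul_comm, ← div_eq_mul_inv] at hr
    exact (ENNReal.le_div_iff_mul_le (Or.inl (volume_ball_ne_zero x r.2))
      (Or.inl (volume_ball_ne_top x r))).1 hr.le
  choose! ρ hρ0 hρ using key
  have hbdd : ∃ R : ℝ, ∀ x ∈ {x | l < hlMax g x}, ρ x ≤ R := by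
    have hv0 := volume_ball_ne_zero (0 : Euc n) one_pos
    have hvt := volume_ball_ne_top (0 : Euc n) 1
    set A : ℝ≥0∞ := (∫⁻ y, g y) / (l * volume (ball (0 : Euc n) 1)) with hA
    have hAt : A ≠ ∞ := ENNReal.div_ne_top hI (mul_ne_zero hl hv0)
    refine ⟨max 1 A.toReal, fun x hx => ?_⟩
    have h1 : l * (ENNReal.ofReal (ρ x ^ n) * volume (ball (0 : Euc n) 1)) ≤ ∫⁻ y, g y := by
      have := volume_ball_mul hn x (hρ0 x hx).le 1
      rw [mul_one, Measure.addHaar_ball_center _ x 1] at this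
      rw [← this]
      exact (hρ x hx).trans (setLIntegral_le_lintegral _ _)
    have hlt : l ≠ ∞ := fun h => by simp [h] at hx
    have h2 : ENNReal.ofReal (ρ x ^ n) ≤ A := by
      rw [hA, ENNReal.le_div_iff_mul_le (Or.inl (mul_ne_zero hl hv0))
        (Or.inl (ENNReal.mul_ne_top hlt hvt))]
      calc _ = _ := by ring
        _ ≤ _ := h1
    rw [ENNReal.ofReal_le_iff_le_toReal hAt] at h2
    by_contra! hcon
    have h3 : 1 ≤ ρ x := (le_max_left _ _).trans hcon.le
    have h4 : ρ x ≤ ρ x ^ n := le_self_pow₀ h3 (by omega)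
    exact absurd ((le_max_right 1 A.toReal).trans_lt hcon) (by linarith)
  obtain ⟨R, hR⟩ := hbdd
  obtain ⟨u, hut, hdisj, hcov⟩ := Vitali.exists_disjoint_subfamily_covering_enlargement_ball
    {x | l < hlMax g x} (fun x => x) ρ R hR 4 (by norm_num)
  have hucount : u.Countable := hdisj.countable_of_isOpen (fun _ _ => isOpen_ball)
    fun x hx => ⟨x, mem_ball_self (hρ0 x (hut hx))⟩
  have : Countable u := hucount.to_subtype
  have hsub : {x | l < hlMax g x} ⊆ ⋃ x : u, ball (x : Euc n) (4 * ρ x) := by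
    intro x hx
    obtain ⟨b, hb, hxb⟩ := hcov x hx
    exact Set.mem_iUnion.2 ⟨⟨b, hb⟩, hxb (mem_ball_self (hρ0 x hx))⟩
  calc l * volume {x | l < hlMax g x}
      ≤ l * ∑' x : u, volume (ball (x : Euc n) (4 * ρ x)) := by
        gcongr
        exact (measure_mono hsub).trans (measure_iUnion_le _)
    _ = ENNReal.ofReal (4 ^ n) * ∑' x : u, l * volume (ball (x : Euc n) (ρ x)) := by
        simp_rw [volume_ball_mul hn _ (by norm_num : (0 : ℝ) ≤ 4), ENNReal.tsum_mul_left]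
        ring
    _ ≤ ENNReal.ofReal (4 ^ n) * ∑' x : u, ∫⁻ y in ball (x : Euc n) (ρ x), g y := by
        gcongr with x
        exact hρ x (hut x.2)
    _ = ENNReal.ofReal (4 ^ n) * ∫⁻ y in ⋃ x : u, ball (x : Euc n) (ρ x), g y := by
        rw [lintegral_iUnion (fun _ => measurableSet_ball) (hdisj.subtype _ _)]
    _ ≤ _ := by
        exact mul_le_mul_right (setLIntegral_le_lintegral _ _) _

theorem mul_volume_lt_hlMax_le_setLIntegral {n : ℕ} (hn : 1 ≤ n) {g : Euc n → ℝ≥0∞}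
    (hg : Measurable g) {l : ℝ≥0∞} (hl : l ≠ 0) :
    l * volume {x | l < hlMax g x} ≤
      2 * ENNReal.ofReal (4 ^ n) * ∫⁻ y in {y | l < 2 * g y}, g y := by
  rcases eq_or_ne l ∞ with rfl | hlt
  · simp
  have hS : MeasurableSet {y | l < 2 * g y} :=
    measurableSet_lt measurable_const (hg.const_mul 2)
  have hpt : ∀ x, hlMax g x ≤ hlMax ({y | l < 2 * g y}.indicator g) x + l / 2 := by
    intro x
    refine iSup_le fun r => ?_
    have hgle : ∀ y, g y ≤ {y | l < 2 * g y}.indicator g y + l / 2 := by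
      intro y
      by_cases hy : l < 2 * g y
      · rw [Set.indicator_of_mem (by exact hy)]
        exact le_self_add
      · rw [Set.indicator_of_notMem (by exact hy), zero_add,
          ENNReal.le_div_iff_mul_le (by simp) (by simp), mul_comm]
        exact not_lt.1 hy
    calc (volume (ball x (r : ℝ)))⁻¹ * ∫⁻ y in ball x (r : ℝ), g y
        ≤ (volume (ball x (r : ℝ)))⁻¹ * ∫⁻ y in ball x (r : ℝ),
          ({y | l < 2 * g y}.indicator g y + l / 2) := by
          gcongr with y
          exact hgle y
      _ = (volume (ball x (r : ℝ)))⁻¹ * (∫⁻ y in ball x (r : ℝ),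
          {y | l < 2 * g y}.indicator g y) + l / 2 := by
          rw [lintegral_add_right _ measurable_const, mul_add, setLIntegral_const,
            mul_comm (l / 2), ← mul_assoc, ENNReal.inv_mul_cancel
            (volume_ball_ne_zero x r.2) (volume_ball_ne_top x r), one_mul]
      _ ≤ _ := by
          gcongr
          exact le_iSup (fun r : Set.Ioi (0 : ℝ) => (volume (ball x (r : ℝ)))⁻¹ *
            ∫⁻ y in ball x (r : ℝ), {y | l < 2 * g y}.indicator g y) r
  have hsub : {x | l < hlMax g x} ⊆ {x | l / 2 < hlMax ({y | l < 2 * g y}.indicator g) x} := by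
    intro x hx
    by_contra hcon
    have h1 := (hpt x).trans (add_le_add_left (not_lt.1 hcon) (l / 2))
    rw [ENNReal.add_halves] at h1
    exact absurd hx (not_lt.2 h1)
  have hl2 : l / 2 ≠ 0 := (ENNReal.half_pos hl).ne'
  calc l * volume {x | l < hlMax g x}
      ≤ 2 * (l / 2) * volume {x | l / 2 < hlMax ({y | l < 2 * g y}.indicator g) x} := by
        rw [ENNReal.mul_div_cancel (by simp) (by simp)]
        gcongr
    _ ≤ _ := by
        rw [mul_assoc, mul_assoc, ← lintegral_indicator hS]
        exact mul_le_mul_right (mul_volume_lt_hlMax_le hn _ hl2) _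

/-- The layer cake formula for powers of an extended nonnegative real. -/
theorem ENNReal.rpow_eq_mul_lintegral_lt (a : ℝ≥0∞) {p : ℝ} (hp : 0 < p) :
    a ^ p = ENNReal.ofReal p * ∫⁻ t in Set.Ioi (0 : ℝ),
      if ENNReal.ofReal t < a then ENNReal.ofReal (t ^ (p - 1)) else 0 := by
  have hfin : ∀ b : ℝ, 0 ≤ b → ENNReal.ofReal b ^ p =
      ENNReal.ofReal p * ∫⁻ t in Set.Ioi (0 : ℝ),
        if ENNReal.ofReal t < ENNReal.ofReal b then ENNReal.ofReal (t ^ (p - 1)) else 0 := by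
    intro b hb
    have h1 : ∫⁻ t in Set.Ioi (0 : ℝ), (if ENNReal.ofReal t < ENNReal.ofReal b then
        ENNReal.ofReal (t ^ (p - 1)) else 0) = ∫⁻ t in Set.Ioo 0 b, ENNReal.ofReal (t ^ (p - 1)) := by
      rw [← lintegral_indicator measurableSet_Ioi, ← lintegral_indicator measurableSet_Ioo]
      congr 1
      ext t
      by_cases ht : 0 < t
      · by_cases htb : t < b
        · simp [ht, htb, ENNReal.ofReal_lt_ofReal_iff (ht.trans htb)]
        · have : ¬ ENNReal.ofReal t < ENNReal.ofReal b :=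
            not_lt.2 (ENNReal.ofReal_le_ofReal (not_lt.1 htb))
          simp [ht, htb, this]
      · simp [ht]
    have hint : IntervalIntegrable (fun t : ℝ => t ^ (p - 1)) volume 0 b :=
      intervalIntegral.intervalIntegrable_rpow' (by linarith)
    rw [h1, restrict_Ioo_eq_restrict_Ioc, ← ofReal_integral_eq_lintegral_ofReal
      ((intervalIntegrable_iff_integrableOn_Ioc_of_le hb).1 hint)
      ((ae_restrict_iff' measurableSet_Ioc).2 (.of_forall fun t ht => Real.rpow_nonneg ht.1.le _)),
      ← intervalIntegral.integral_of_le hb, integral_rpow (Or.inl (by linarith)),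
      ← ENNReal.ofReal_mul hp.le, ENNReal.ofReal_rpow_of_nonneg hb hp.le]
    rw [sub_add_cancel, Real.zero_rpow hp.ne']
    congr 1
    field_simp
    ring
  rcases eq_or_ne a ∞ with rfl | ha
  · rw [ENNReal.top_rpow_of_pos hp]
    symm
    by_contra hcon
    have hroot : ∀ k : ℕ, (k : ℝ≥0∞) ≤ (ENNReal.ofReal p * ∫⁻ t in Set.Ioi (0 : ℝ),
        if ENNReal.ofReal t < ∞ then ENNReal.ofReal (t ^ (p - 1)) else 0) ^ (1 / p) := by
      intro k
      rw [one_div, ENNReal.le_rpow_inv_iff hp, ← ENNReal.ofReal_natCast k,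
        hfin k (Nat.cast_nonneg k)]
      gcongr with t
      split_ifs <;> simp_all
    obtain ⟨k, hk⟩ := ENNReal.exists_nat_gt
      (ENNReal.rpow_ne_top_of_nonneg (by positivity : 0 ≤ 1 / p) hcon)
    exact absurd (hroot k) (not_le.2 hk)
  · have := hfin a.toReal ENNReal.toReal_nonneg
    rwa [ENNReal.ofReal_toReal ha] at this

/-- The strong type `(p,p)` inequality for the Hardy–Littlewood maximal function. -/
theorem exists_lintegral_hlMax_rpow_le {n : ℕ} (hn : 1 ≤ n) {p : ℝ} (hp : 1 < p) :
    ∃ C : ℝ≥0∞, C ≠ ∞ ∧ ∀ g : Euc n → ℝ≥0∞, Measurable g →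
      ∫⁻ x, hlMax g x ^ p ≤ C * ∫⁻ x, g x ^ p := by
  have hp0 : 0 < p := by linarith
  have hp1 : 0 < p - 1 := by linarith
  refine ⟨ENNReal.ofReal p * (2 * ENNReal.ofReal (4 ^ n)) *
    ((ENNReal.ofReal (p - 1))⁻¹ * 2 ^ (p - 1)), ?_, fun g hg => ?_⟩
  · have h1 : (ENNReal.ofReal (p - 1))⁻¹ ≠ ∞ :=
      ENNReal.inv_ne_top.2 (ENNReal.ofReal_pos.2 hp1).ne'
    have h2 : (2 : ℝ≥0∞) ^ (p - 1) ≠ ∞ := ENNReal.rpow_ne_top_of_nonneg hp1.le (by simp)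
    finiteness
  have hM : Measurable (hlMax g) := measurable_hlMax hg
  have hmeas : ∀ {G : Euc n → ℝ≥0∞}, Measurable G → ∀ q : ℝ, Measurable
      fun z : Euc n × ℝ => if ENNReal.ofReal z.2 < G z.1 then ENNReal.ofReal (z.2 ^ q) else 0 :=
    fun hG q => Measurable.ite (measurableSet_lt (by fun_prop) (by fun_prop))
      (by fun_prop) measurable_const
  have hinner : ∀ y, ∫⁻ t in Set.Ioi (0 : ℝ), (if ENNReal.ofReal t < 2 * g y then
      ENNReal.ofReal (t ^ (p - 1 - 1)) else 0) =
      (ENNReal.ofReal (p - 1))⁻¹ * (2 * g y) ^ (p - 1) := by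
    intro y
    rw [ENNReal.rpow_eq_mul_lintegral_lt (2 * g y) hp1, ← mul_assoc,
      ENNReal.inv_mul_cancel (ENNReal.ofReal_pos.2 hp1).ne' ENNReal.ofReal_ne_top, one_mul]
  calc ∫⁻ x, hlMax g x ^ p
      = ENNReal.ofReal p * ∫⁻ x, ∫⁻ t in Set.Ioi (0 : ℝ),
          (if ENNReal.ofReal t < hlMax g x then ENNReal.ofReal (t ^ (p - 1)) else 0) := by
        simp_rw [fun x => ENNReal.rpow_eq_mul_lintegral_lt (hlMax g x) hp0]
        rw [lintegral_const_mul' _ _ ENNReal.ofReal_ne_top]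
    _ = ENNReal.ofReal p * ∫⁻ t in Set.Ioi (0 : ℝ), ∫⁻ x,
          (if ENNReal.ofReal t < hlMax g x then ENNReal.ofReal (t ^ (p - 1)) else 0) := by
        rw [lintegral_lintegral_swap (hmeas hM _).aemeasurable]
    _ ≤ ENNReal.ofReal p * ∫⁻ t in Set.Ioi (0 : ℝ), 2 * ENNReal.ofReal (4 ^ n) * ∫⁻ y,
          g y * (if ENNReal.ofReal t < 2 * g y then
            ENNReal.ofReal (t ^ (p - 1 - 1)) else 0) := by
        refine mul_le_mul_right (setLIntegral_mono' measurableSet_Ioi fun t ht => ?_) _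
        have ht : 0 < t := ht
        have h1 : ∫⁻ x, (if ENNReal.ofReal t < hlMax g x then
            ENNReal.ofReal (t ^ (p - 1)) else 0) =
            ENNReal.ofReal (t ^ (p - 1)) * volume {x | ENNReal.ofReal t < hlMax g x} := by
          rw [← lintegral_indicator_const (measurableSet_lt measurable_const hM)]
          refine lintegral_congr fun x => ?_
          by_cases hx : ENNReal.ofReal t < hlMax g x
          · rw [if_pos hx, Set.indicator_of_mem (by exact hx)]
          · rw [if_neg hx, Set.indicator_of_notMem (by exact hx)]
        have h2 : ∫⁻ y, g y * (if ENNReal.ofReal t < 2 * g y then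
            ENNReal.ofReal (t ^ (p - 1 - 1)) else 0) =
            ENNReal.ofReal (t ^ (p - 1 - 1)) * ∫⁻ y in {y | ENNReal.ofReal t < 2 * g y}, g y := by
          rw [← lintegral_indicator (measurableSet_lt measurable_const (hg.const_mul 2)),
            ← lintegral_const_mul' _ _ ENNReal.ofReal_ne_top]
          congr 1
          ext y
          by_cases hy : ENNReal.ofReal t < 2 * g y
          · rw [if_pos hy, Set.indicator_of_mem (by exact hy), mul_comm]
          · rw [if_neg hy, Set.indicator_of_notMem (by exact hy), mul_zero, mul_zero]
        have h3 : t ^ (p - 1) = t ^ (p - 1 - 1) * t := by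
          rw [← Real.rpow_add_one ht.ne']
          ring_nf
        rw [h1, h2, h3, ENNReal.ofReal_mul (by positivity), mul_assoc, mul_left_comm (2 * _)]
        exact mul_le_mul_right
          (mul_volume_lt_hlMax_le_setLIntegral hn hg (ENNReal.ofReal_pos.2 ht).ne') _
    _ = ENNReal.ofReal p * (2 * ENNReal.ofReal (4 ^ n)) * ∫⁻ y, g y * ∫⁻ t in Set.Ioi (0 : ℝ),
          (if ENNReal.ofReal t < 2 * g y then ENNReal.ofReal (t ^ (p - 1 - 1)) else 0) := by
        rw [lintegral_const_mul' _ _ (by finiteness), ← mul_assoc]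
        congr 1
        rw [← lintegral_lintegral_swap ((hg.comp measurable_fst).mul
          (hmeas (hg.const_mul 2) _)).aemeasurable]
        refine lintegral_congr fun y => ?_
        exact lintegral_const_mul _ ((hmeas (hg.const_mul 2) _).comp measurable_prodMk_left)
    _ = ENNReal.ofReal p * (2 * ENNReal.ofReal (4 ^ n)) *
          ((ENNReal.ofReal (p - 1))⁻¹ * 2 ^ (p - 1) * ∫⁻ y, g y ^ p) := by
        rw [← lintegral_const_mul _ (hg.pow_const p)]
        congr 1
        refine lintegral_congr fun y => ?_
        have h4 : g y ^ p = g y * g y ^ (p - 1) := by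
          conv_rhs => enter [1]; rw [← ENNReal.rpow_one (g y)]
          rw [← ENNReal.rpow_add_of_nonneg _ _ zero_le_one hp1.le]
          ring_nf
        rw [hinner, ENNReal.mul_rpow_of_nonneg _ _ hp1.le, h4]
        ring
    _ = _ := by ring

theorem setLAverage_rpow_le {n : ℕ} {g : Euc n → ℝ≥0∞} (hg : Measurable g) {p : ℝ} (hp : 1 < p)
    (x : Euc n) {r : ℝ} (hr : 0 < r) :
    ((volume (ball x r))⁻¹ * ∫⁻ y in ball x r, g y) ^ p ≤
      (volume (ball x r))⁻¹ * ∫⁻ y in ball x r, g y ^ p := by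
  have hp0 : 0 < p := by linarith
  have hv0 := volume_ball_ne_zero x hr
  have hvt := volume_ball_ne_top x r
  have hpq := Real.HolderConjugate.conjExponent hp
  have h := ENNReal.lintegral_mul_le_Lp_mul_Lq (volume.restrict (ball x r)) hpq
    hg.aemeasurable (aemeasurable_const (b := (1 : ℝ≥0∞)))
  simp only [Pi.mul_apply, mul_one, ENNReal.one_rpow, lintegral_const, one_mul,
    Measure.restrict_apply MeasurableSet.univ, Set.univ_inter] at h
  have hexp : 1 / p.conjExponent * p = p - 1 := by
    have := hpq.one_div_add_one_div
    have h1 : 1 / p.conjExponent = 1 - 1 / p := by linarith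
    rw [h1]
    field_simp
  calc ((volume (ball x r))⁻¹ * ∫⁻ y in ball x r, g y) ^ p
      ≤ ((volume (ball x r))⁻¹ * ((∫⁻ y in ball x r, g y ^ p) ^ (1 / p) *
          volume (ball x r) ^ (1 / p.conjExponent))) ^ p := by gcongr
    _ = (volume (ball x r) ^ (-p) * volume (ball x r) ^ (p - 1)) *
          ∫⁻ y in ball x r, g y ^ p := by
        rw [ENNReal.mul_rpow_of_nonneg _ _ hp0.le, ENNReal.mul_rpow_of_nonneg _ _ hp0.le,
          ← ENNReal.rpow_mul, ← ENNReal.rpow_mul, hexp, one_div, inv_mul_cancel₀ hp0.ne',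
          ENNReal.rpow_one, ENNReal.inv_rpow, ENNReal.rpow_neg]
        ring
    _ = _ := by
        rw [← ENNReal.rpow_add _ _ hv0 hvt, ← ENNReal.rpow_neg_one]
        congr 2
        ring

theorem setLIntegral_rpow_le_morreyNormE {n : ℕ} {p : ℝ} (hp : 0 < p) (κ : ℝ)
    (g : Euc n → ℝ≥0∞) (z : Euc n) {r : ℝ} (hr : 0 < r) :
    ∫⁻ y in ball z r, g y ^ p ≤ volume (ball z r) ^ κ * morreyNormE p κ g ^ p := by
  have hv0 := volume_ball_ne_zero z hr
  have hvt := volume_ball_ne_top z r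
  have h : (volume (ball z r) ^ (-κ) * ∫⁻ y in ball z r, g y ^ p) ^ (1 / p) ≤
      morreyNormE p κ g :=
    le_iSup₂_of_le z (⟨r, hr⟩ : Set.Ioi (0 : ℝ)) le_rfl
  rw [one_div, ENNReal.rpow_inv_le_iff hp] at h
  calc ∫⁻ y in ball z r, g y ^ p
      = volume (ball z r) ^ κ * (volume (ball z r) ^ (-κ) * ∫⁻ y in ball z r, g y ^ p) := by
        rw [← mul_assoc, ← ENNReal.rpow_add _ _ hv0 hvt, add_neg_cancel, ENNReal.rpow_zero,
          one_mul]
    _ ≤ _ := by gcongr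

theorem hlMax_rpow_le_of_mem_ball {n : ℕ} {g : Euc n → ℝ≥0∞} (hg : Measurable g) {p κ : ℝ}
    (hp : 1 < p) (hκ : κ < 1) {x z : Euc n} {r : ℝ} (hx : x ∈ ball z r) :
    hlMax g x ^ p ≤ hlMax ((ball z (2 * r)).indicator g) x ^ p +
      volume (ball z r) ^ (κ - 1) * morreyNormE p κ g ^ p := by
  have hp0 : 0 < p := by linarith
  rw [← ENNReal.le_rpow_inv_iff hp0]
  refine iSup_le fun s => ?_
  have hs : (0 : ℝ) < s := s.2
  rw [ENNReal.le_rpow_inv_iff hp0]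
  rcases le_or_gt (s : ℝ) r with hsr | hsr
  · refine le_add_right (ENNReal.rpow_le_rpow ?_ hp0.le)
    have hsub : ball x (s : ℝ) ⊆ ball z (2 * r) :=
      ball_subset_ball' (by rw [mem_ball] at hx; linarith)
    refine le_iSup_of_le s (mul_le_mul_right (le_of_eq ?_) _)
    exact setLIntegral_congr_fun measurableSet_ball fun y hy =>
      (Set.indicator_of_mem (hsub hy) g).symm
  · refine le_add_left ((setLAverage_rpow_le hg hp x hs).trans ?_)
    have hv0 := volume_ball_ne_zero x hs
    have hvt := volume_ball_ne_top x (s : ℝ)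
    calc (volume (ball x (s : ℝ)))⁻¹ * ∫⁻ y in ball x (s : ℝ), g y ^ p
        ≤ (volume (ball x (s : ℝ)))⁻¹ *
            (volume (ball x (s : ℝ)) ^ κ * morreyNormE p κ g ^ p) :=
          mul_le_mul_right (setLIntegral_rpow_le_morreyNormE hp0 κ g x hs) _
      _ = volume (ball x (s : ℝ)) ^ (κ - 1) * morreyNormE p κ g ^ p := by
          rw [← mul_assoc, ← ENNReal.rpow_neg_one, ← ENNReal.rpow_add _ _ hv0 hvt]
          ring_nf
      _ ≤ _ := by
          refine mul_le_mul_left ?_ _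
          rw [Measure.addHaar_ball_center volume x, Measure.addHaar_ball_center volume z]
          rw [← neg_sub, ENNReal.rpow_neg, ENNReal.rpow_neg, ENNReal.inv_le_inv]
          exact ENNReal.rpow_le_rpow (measure_mono (ball_subset_ball hsr.le)) (by linarith)

/-- The Hardy–Littlewood maximal function is bounded on Morrey spaces. -/
theorem exists_morreyNormE_hlMax_le {n : ℕ} (hn : 1 ≤ n) {p κ : ℝ} (hp : 1 < p) (hκ0 : 0 < κ)
    (hκ1 : κ < 1) :
    ∃ C : ℝ≥0∞, C ≠ ∞ ∧ ∀ g : Euc n → ℝ≥0∞, Measurable g →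
      morreyNormE p κ (hlMax g) ≤ C * morreyNormE p κ g := by
  have hp0 : 0 < p := by linarith
  obtain ⟨A, hA, hAg⟩ := exists_lintegral_hlMax_rpow_le hn hp
  refine ⟨(A * ENNReal.ofReal (2 ^ n) ^ κ + 1) ^ p⁻¹, ?_, fun g hg => ?_⟩
  · have : ENNReal.ofReal (2 ^ n) ^ κ ≠ ∞ :=
      ENNReal.rpow_ne_top_of_nonneg hκ0.le ENNReal.ofReal_ne_top
    exact ENNReal.rpow_ne_top_of_nonneg (by positivity) (by finiteness)
  refine iSup₂_le fun z r => ?_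
  have hr : (0 : ℝ) < r := r.2
  have hv0 := volume_ball_ne_zero z hr
  have hvt := volume_ball_ne_top z (r : ℝ)
  rw [one_div, ENNReal.rpow_inv_le_iff hp0, ENNReal.mul_rpow_of_nonneg _ _ hp0.le,
    ENNReal.rpow_inv_rpow hp0.ne']
  set v := volume (ball z (r : ℝ)) with hv
  set N := morreyNormE p κ g ^ p with hN
  have hcancel : v ^ (-κ) * v ^ κ = 1 := by
    rw [← ENNReal.rpow_add _ _ hv0 hvt, neg_add_cancel, ENNReal.rpow_zero]
  have hlocal : ∫⁻ y in ball z (r : ℝ), hlMax ((ball z (2 * (r : ℝ))).indicator g) y ^ p ≤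
      A * (ENNReal.ofReal (2 ^ n) ^ κ * v ^ κ * N) := by
    calc ∫⁻ y in ball z (r : ℝ), hlMax ((ball z (2 * (r : ℝ))).indicator g) y ^ p
        ≤ ∫⁻ y, hlMax ((ball z (2 * (r : ℝ))).indicator g) y ^ p :=
          setLIntegral_le_lintegral _ _
      _ ≤ A * ∫⁻ y, (ball z (2 * (r : ℝ))).indicator g y ^ p :=
          hAg _ (hg.indicator measurableSet_ball)
      _ = A * ∫⁻ y in ball z (2 * (r : ℝ)), g y ^ p := by
          rw [← lintegral_indicator measurableSet_ball]
          congr 2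
          ext y
          by_cases hy : y ∈ ball z (2 * (r : ℝ))
          · rw [Set.indicator_of_mem hy, Set.indicator_of_mem hy]
          · rw [Set.indicator_of_notMem hy, Set.indicator_of_notMem hy,
              ENNReal.zero_rpow_of_pos hp0]
      _ ≤ A * (volume (ball z (2 * (r : ℝ))) ^ κ * N) :=
          mul_le_mul_right
            (setLIntegral_rpow_le_morreyNormE hp0 κ g z (by positivity)) _
      _ = _ := by
          rw [volume_ball_mul hn z (by norm_num), ENNReal.mul_rpow_of_nonneg _ _ hκ0.le]
  calc v ^ (-κ) * ∫⁻ y in ball z (r : ℝ), hlMax g y ^ p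
      ≤ v ^ (-κ) * ∫⁻ y in ball z (r : ℝ),
          (hlMax ((ball z (2 * (r : ℝ))).indicator g) y ^ p + v ^ (κ - 1) * N) :=
        mul_le_mul_right (setLIntegral_mono' measurableSet_ball fun y hy =>
          hlMax_rpow_le_of_mem_ball hg hp hκ1 hy) _
    _ ≤ v ^ (-κ) * (A * (ENNReal.ofReal (2 ^ n) ^ κ * v ^ κ * N) + v ^ κ * N) := by
        refine mul_le_mul_right ?_ _
        rw [lintegral_add_right _ measurable_const, setLIntegral_const]
        refine add_le_add hlocal (le_of_eq ?_)
        rw [← hv, mul_right_comm]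
        conv_lhs => enter [1, 2]; rw [← ENNReal.rpow_one v]
        rw [← ENNReal.rpow_add _ _ hv0 hvt, sub_add_cancel]
    _ = (v ^ (-κ) * v ^ κ) * ((A * ENNReal.ofReal (2 ^ n) ^ κ + 1) * N) := by ring
    _ = _ := by rw [hcancel, one_mul]

theorem multiM_le_prod_hlMax {n m : ℕ} (f : Fin m → Euc n → ℝ) (x : Euc n) :
    multiM m f x ≤ ∏ i, hlMax (fun y => ENNReal.ofReal |f i y|) x :=
  iSup_le fun r => Finset.prod_le_prod' fun i _ =>
    le_iSup (fun r : Set.Ioi (0 : ℝ) => (volume (ball x (r : ℝ)))⁻¹ *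
      ∫⁻ y in ball x (r : ℝ), ENNReal.ofReal |f i y|) r

theorem ENNReal.rpow_sum_of_ne_zero_of_ne_top {ι : Type*} {a : ℝ≥0∞} (h0 : a ≠ 0) (ht : a ≠ ∞)
    (s : Finset ι) (w : ι → ℝ) : a ^ ∑ i ∈ s, w i = ∏ i ∈ s, a ^ w i := by
  classical
  induction s using Finset.induction with
  | empty => simp
  | insert i s hi ih =>
    rw [Finset.sum_insert hi, Finset.prod_insert hi, ENNReal.rpow_add _ _ h0 ht, ih]

/-- Hölder's inequality in Morrey spaces. -/
theorem morreyNormE_prod_le {n m : ℕ} (κ : ℝ) {p : Fin m → ℝ} (hp : ∀ i, 0 < p i) {P : ℝ}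
    (hP0 : 0 < P) (hP : 1 / P = ∑ i, 1 / p i) {F : Fin m → Euc n → ℝ≥0∞}
    (hF : ∀ i, Measurable (F i)) :
    morreyNormE P κ (fun x => ∏ i, F i x) ≤ ∏ i, morreyNormE (p i) κ (F i) := by
  refine iSup₂_le fun z r => ?_
  have hr : (0 : ℝ) < r := r.2
  have hsum : ∑ i, P / p i = 1 := by
    have : ∑ i, P / p i = P * ∑ i, 1 / p i := by
      rw [Finset.mul_sum]
      exact Finset.sum_congr rfl fun i _ => by ring
    rw [this, ← hP, mul_one_div_cancel hP0.ne']
  have hw : ∀ i, 0 ≤ P / p i := fun i => (div_pos hP0 (hp i)).le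
  have hint : volume (ball z (r : ℝ)) ^ (-κ) * ∫⁻ y in ball z (r : ℝ), (∏ i, F i y) ^ P ≤
      ∏ i, (volume (ball z (r : ℝ)) ^ (-κ) * ∫⁻ y in ball z (r : ℝ), F i y ^ p i) ^ (P / p i) := by
    have hv : volume (ball z (r : ℝ)) ^ (-κ) ≠ ∞ := by
      simp [ENNReal.rpow_eq_top_iff, volume_ball_ne_zero z hr, volume_ball_ne_top z (r : ℝ)]
    have h := ENNReal.lintegral_prod_norm_pow_le (μ := volume.restrict (ball z (r : ℝ)))
      Finset.univ
      (f := fun i y => volume (ball z (r : ℝ)) ^ (-κ) * F i y ^ p i)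
      (fun i _ => (((hF i).pow_const _).const_mul _).aemeasurable) hsum (fun i _ => hw i)
    simp_rw [lintegral_const_mul' _ _ hv] at h
    refine le_trans (le_of_eq ?_) h
    rw [← lintegral_const_mul' _ _ hv]
    refine lintegral_congr fun y => ?_
    have h1 : ∏ i, (volume (ball z (r : ℝ)) ^ (-κ)) ^ (P / p i) =
        volume (ball z (r : ℝ)) ^ (-κ) := by
      have hv0 : volume (ball z (r : ℝ)) ^ (-κ) ≠ 0 := by
        simp [ENNReal.rpow_eq_zero_iff, volume_ball_ne_zero z hr, volume_ball_ne_top z (r : ℝ)]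
      rw [← ENNReal.rpow_sum_of_ne_zero_of_ne_top hv0 hv, hsum, ENNReal.rpow_one]
    have h2 : ∀ i, (volume (ball z (r : ℝ)) ^ (-κ) * F i y ^ p i) ^ (P / p i) =
        (volume (ball z (r : ℝ)) ^ (-κ)) ^ (P / p i) * F i y ^ P := by
      intro i
      rw [ENNReal.mul_rpow_of_nonneg _ _ (hw i), ← ENNReal.rpow_mul (F i y),
        mul_div_cancel₀ _ (hp i).ne']
    simp_rw [h2]
    rw [Finset.prod_mul_distrib, h1, ENNReal.prod_rpow_of_nonneg hP0.le]
  calc (volume (ball z (r : ℝ)) ^ (-κ) *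
        ∫⁻ y in ball z (r : ℝ), (∏ i, F i y) ^ P) ^ (1 / P)
      ≤ (∏ i, (volume (ball z (r : ℝ)) ^ (-κ) *
          ∫⁻ y in ball z (r : ℝ), F i y ^ p i) ^ (P / p i)) ^ (1 / P) :=
        ENNReal.rpow_le_rpow hint (by positivity)
    _ = ∏ i, (volume (ball z (r : ℝ)) ^ (-κ) *
          ∫⁻ y in ball z (r : ℝ), F i y ^ p i) ^ (1 / p i) := by
        rw [← ENNReal.prod_rpow_of_nonneg (by positivity)]
        refine Finset.prod_congr rfl fun i _ => ?_
        rw [← ENNReal.rpow_mul]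
        congr 1
        field_simp
    _ ≤ _ := Finset.prod_le_prod' fun i _ => le_iSup₂_of_le z r le_rfl

theorem morreyNormE_mono {n : ℕ} {p : ℝ} (hp : 0 < p) (κ : ℝ) {F G : Euc n → ℝ≥0∞}
    (h : ∀ x, F x ≤ G x) : morreyNormE p κ F ≤ morreyNormE p κ G := by
  refine iSup₂_mono fun z r => ENNReal.rpow_le_rpow (mul_le_mul_right ?_ _) (by positivity)
  exact lintegral_mono fun y => ENNReal.rpow_le_rpow (h y) hp.le

/-- Strong type boundedness of the multilinear maximal operator on Morrey spaces. -/
theorem stmt7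
    (n m : ℕ) (hn : 1 ≤ n) (hm : 1 ≤ m) (κ : ℝ) (hκ0 : 0 < κ) (hκ1 : κ < 1)
    (p : Fin m → ℝ) (hp : ∀ i, 1 < p i) (P : ℝ) (hP : 1 / P = ∑ i, 1 / p i) :
    ∃ C : ℝ, 0 < C ∧ ∀ f : Fin m → Euc n → ℝ,
      (∀ i, Measurable (f i)) → (∀ i, morreyNorm (p i) κ (f i) < ⊤) →
      morreyNormE P κ (multiM m f) ≤
        ENNReal.ofReal C * ∏ i, morreyNorm (p i) κ (f i) := by
  have hp0 : ∀ i, 0 < p i := fun i => one_pos.trans (hp i)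
  have hP0 : 0 < P := by
    rw [← one_div_pos, hP]
    exact Finset.sum_pos (fun i _ => one_div_pos.2 (hp0 i)) ⟨⟨0, hm⟩, Finset.mem_univ _⟩
  choose A hA hAg using fun i => exists_morreyNormE_hlMax_le hn (hp i) hκ0 hκ1
  have hAt : ∏ i, A i ≠ ∞ := ENNReal.prod_ne_top fun i _ => hA i
  refine ⟨(∏ i, A i).toReal + 1, by positivity, fun f hf _ => ?_⟩
  have hg : ∀ i, Measurable fun y => ENNReal.ofReal |f i y| := fun i =>
    ((measurable_norm.comp (hf i)).ennreal_ofReal)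
  calc morreyNormE P κ (multiM m f)
      ≤ morreyNormE P κ fun x => ∏ i, hlMax (fun y => ENNReal.ofReal |f i y|) x :=
        morreyNormE_mono hP0 κ (multiM_le_prod_hlMax f)
    _ ≤ ∏ i, morreyNormE (p i) κ (hlMax fun y => ENNReal.ofReal |f i y|) :=
        morreyNormE_prod_le κ hp0 hP0 hP fun i => measurable_hlMax (hg i)
    _ ≤ ∏ i, A i * morreyNorm (p i) κ (f i) :=
        Finset.prod_le_prod' fun i _ => hAg i _ (hg i)
    _ = (∏ i, A i) * ∏ i, morreyNorm (p i) κ (f i) := Finset.prod_mul_distrib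
    _ ≤ _ := by
        refine mul_le_mul_left ?_ _
        rw [← ENNReal.ofReal_toReal hAt]
        exact ENNReal.ofReal_le_ofReal (by rw [ENNReal.ofReal_toReal hAt]; linarith)

end
end

section
/- Let n ≥ 2, m ≥ 1, 0 < α < mn, 1 < s ≤ ∞, and let Ω⃗ = (Ω_1,…,Ω_m) ∈ L^s(S^{n−1}). Let s' ≤ p_1,…,p_m < ∞ with s' = min{p_1,…,p_m}, let 1/p = 1/p_1 + ⋯ + 1/p_m with s'/m ≤ p < n/α, let 0 < κ < 1 − αp/n, and define q by 1/q = 1/p − α/(n(1−κ)). Then there exists a constant C > 0, independent of f⃗, such that for all measurable f_i with ‖f_i‖_{L^{p_i,κ}} < ∞ (i = 1,…,m), ‖T_{Ω,α;m}(f⃗)‖_{WL^{q,κ}} ≤ C ∏_{i=1}^m ‖f_i‖_{L^{p_i,κ}}. -/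
open MeasureTheory Metric ENNReal

noncomputable section

/-- A function in `L^s` of the sphere, extended homogeneously, lies in `L^s` of the unit ball. -/
theorem memLp_restrict_unitBall {n : ℕ} (hn : 2 ≤ n) {s : ℝ≥0∞} {Ω : Euc n → ℝ}
    (hΩ : MemSphereLp n s Ω) : MemLp Ω s (volume.restrict (ball (0 : Euc n) 1)) := by
  obtain ⟨hm, hh, hfin⟩ := hΩ
  have hsph : MemLp (fun θ : sphere (0 : Euc n) 1 => Ω θ.1) s
      ((volume : Measure (Euc n)).toSphere) :=
    ⟨(hm.comp measurable_subtype_coe).aestronglyMeasurable, hfin⟩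
  set ν := Measure.volumeIoiPow (Module.finrank ℝ (Euc n) - 1)
  set I : Set (Set.Ioi (0 : ℝ)) := Set.Iio ⟨1, Set.mem_Ioi.2 one_pos⟩
  have : IsFiniteMeasure (ν.restrict I) := by
    refine ⟨?_⟩
    rw [Measure.restrict_apply_univ, Measure.volumeIoiPow_apply_Iio]
    exact ENNReal.ofReal_lt_top
  have h1 := hsph.comp_fst (ν.restrict I)
  have hmp := (Measure.measurePreserving_homeomorphUnitSphereProd
    (volume : Measure (Euc n))).restrict_preimage
      (MeasurableSet.univ.prod (measurableSet_Iio : MeasurableSet I))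
  rw [← Measure.prod_restrict, Measure.restrict_univ] at hmp
  have h2 := h1.comp_measurePreserving hmp
  have hset : (homeomorphUnitSphereProd (Euc n)) ⁻¹' (Set.univ ×ˢ I)
      = Subtype.val ⁻¹' (ball (0 : Euc n) 1) := by
    ext x
    simp [I, ← Subtype.coe_lt_coe]
  have hfun : ((fun θ : sphere (0 : Euc n) 1 => Ω θ.1) ∘ Prod.fst) ∘
      (homeomorphUnitSphereProd (Euc n)) = Ω ∘ Subtype.val := by
    ext x
    have hx : 0 < ‖x.1‖ := norm_pos_iff.2 x.2
    simpa using hh (inv_pos.2 hx) x.1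
  have hemb : MeasurableEmbedding (Subtype.val : ({0}ᶜ : Set (Euc n)) → Euc n) :=
    MeasurableEmbedding.subtype_coe (measurableSet_singleton _).compl
  have h3 : MemLp (Ω ∘ Subtype.val) s (((volume : Measure (Euc n)).comap
      (Subtype.val : ({0}ᶜ : Set (Euc n)) → Euc n)).restrict
        (Subtype.val ⁻¹' (ball (0 : Euc n) 1))) := by
    rw [← hset, ← hfun]; exact h2
  rw [← hemb.memLp_map_measure_iff, ← hemb.restrict_map, hemb.map_comap] at h3
  have : Nontrivial (Euc n) := by
    have : Nonempty (Fin n) := ⟨⟨0, by omega⟩⟩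
    infer_instance
  have hae : (volume : Measure (Euc n)).restrict
      (Set.range (Subtype.val : ({0}ᶜ : Set (Euc n)) → Euc n)) = volume := by
    rw [Subtype.range_coe]
    exact Measure.restrict_eq_self_of_ae_mem (compl_mem_ae_iff.2 (measure_singleton _))
  rwa [hae] at h3

/-- Tonelli's theorem for a product of functions of separate variables. -/
theorem lintegral_fin_prod {E : Type*} [MeasureSpace E] [SigmaFinite (volume : Measure E)]
    (m : ℕ) (g : Fin m → E → ℝ≥0∞) (hg : ∀ i, Measurable (g i)) :
    ∫⁻ y : Fin m → E, ∏ i, g i (y i) = ∏ i, ∫⁻ y, g i y := by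
  induction m with
  | zero => simp [volume_pi]
  | succ m ih =>
    rw [Fin.prod_univ_succ, ← ih _ fun i => hg i.succ]
    rw [← lintegral_prod_mul (hg 0).aemeasurable
      (Measurable.aemeasurable (by fun_prop))]
    rw [← Measure.volume_eq_prod, ← (volume_preserving_piFinSuccAbove (fun _ : Fin (m+1) => E) 0).lintegral_comp_emb
      (MeasurableEquiv.measurableEmbedding _)]
    simp [Fin.prod_univ_succ, MeasurableEquiv.piFinSuccAbove_apply, Fin.insertNthEquiv]
    rfl

/-- Rescaling an integral over a ball to the unit ball. -/
theorem lintegral_ball_eq_unitBall {n : ℕ} (x : Euc n) {r : ℝ} (hr : 0 < r) (h : Euc n → ℝ≥0∞)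
    (hh : Measurable h) :
    ∫⁻ y in ball x r, h y = ENNReal.ofReal r ^ n * ∫⁻ u in ball (0 : Euc n) 1, h (x - r • u) := by
  have hmap := Measure.map_addHaar_smul (volume : Measure (Euc n)) (inv_pos.2 hr).ne'
  have hset : (fun y => r⁻¹ • (x - y)) ⁻¹' ball (0 : Euc n) 1 = ball x r := by
    ext y
    simp [norm_smul, abs_of_pos hr, dist_eq_norm_sub, inv_mul_lt_iff₀ hr, norm_sub_rev x y]
  have h1 : Measure.map (fun y : Euc n => r⁻¹ • (x - y)) volume =
      ENNReal.ofReal r ^ n • (volume : Measure (Euc n)) := by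
    have h2 : (fun y : Euc n => r⁻¹ • (x - y)) = (r⁻¹ • ·) ∘ (fun y => x - y) := rfl
    rw [h2, ← Measure.map_map (by fun_prop) (by fun_prop),
      (Measure.measurePreserving_sub_left volume x).map_eq, hmap]
    simp [abs_of_pos hr, ENNReal.ofReal_pow hr.le]
  have h3 : ∫⁻ u in ball (0 : Euc n) 1, h (x - r • u)
      ∂(Measure.map (fun y : Euc n => r⁻¹ • (x - y)) volume) = ∫⁻ y in ball x r, h y := by
    rw [setLIntegral_map measurableSet_ball (by fun_prop) (by fun_prop), hset]
    simp [hr.ne']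
  rw [← h3, h1, Measure.restrict_smul, lintegral_smul_measure, smul_eq_mul]

theorem conjExp_holder {s : ℝ≥0∞} (hs : 1 < s) :
    1 ≤ conjExp s ∧ ENNReal.HolderConjugate s (ENNReal.ofReal (conjExp s)) := by
  unfold conjExp
  split_ifs with h
  · subst h
    simp only [le_refl, ENNReal.ofReal_one, true_and]
    infer_instance
  · lift s to NNReal using h
    have hs' : (1 : ℝ) < s := by exact_mod_cast hs
    refine ⟨?_, ?_⟩
    · rw [ENNReal.coe_toReal, le_div_iff₀ (by linarith)]; linarith
    · have : (s : ℝ).HolderConjugate (s / (s - 1)) := Real.HolderConjugate.conjExponent hs'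
      have h2 := this.ennrealOfReal
      simpa using h2

/-- Hölder's inequality for a rough homogeneous kernel, at every scale. -/
theorem lintegral_ball_kernel_mul_le {n : ℕ} (hn : 2 ≤ n) {s : ℝ≥0∞} (hs : 1 < s)
    {Ω : Euc n → ℝ} (hΩ : MemSphereLp n s Ω) {p : ℝ} (hp : conjExp s ≤ p) :
    ∃ K : NNReal, ∀ f : Euc n → ℝ, Measurable f → ∀ (x : Euc n) (r : ℝ), 0 < r →
      ∫⁻ y in ball x r, ‖Ω (x - y) * f y‖ₑ ≤
        K * ENNReal.ofReal r ^ n *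
          ((ENNReal.ofReal r ^ n)⁻¹ * ∫⁻ y in ball x r, ‖f y‖ₑ ^ p) ^ (1 / p) := by
  obtain ⟨ht, hconj⟩ := conjExp_holder hs
  set t := conjExp s
  have hp0 : 0 < p := by linarith
  set μ := (volume : Measure (Euc n)).restrict (ball 0 1)
  have hμ : IsFiniteMeasure μ := ⟨by
    rw [Measure.restrict_apply_univ]; exact measure_ball_lt_top⟩
  have hΩm : Measurable Ω := hΩ.1
  have hmem : MemLp Ω s μ := memLp_restrict_unitBall hn hΩ
  set e : ℝ := 1 / (ENNReal.ofReal t).toReal - 1 / (ENNReal.ofReal p).toReal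
  have he : 0 ≤ e := by
    simp only [e]
    rw [ENNReal.toReal_ofReal (by linarith), ENNReal.toReal_ofReal hp0.le, sub_nonneg]
    exact one_div_le_one_div_of_le (by linarith) hp
  set K : ℝ≥0∞ := eLpNorm Ω s μ * μ Set.univ ^ e
  have hK : K ≠ ⊤ := ENNReal.mul_ne_top hmem.2.ne
    (ENNReal.rpow_ne_top_of_nonneg he (measure_ne_top _ _))
  refine ⟨K.toNNReal, fun f hf x r hr => ?_⟩
  rw [ENNReal.coe_toNNReal hK, lintegral_ball_eq_unitBall x hr _ (by fun_prop),
    lintegral_ball_eq_unitBall x hr _ (by fun_prop), ← mul_assoc _ (_ ^ n),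
    ENNReal.inv_mul_cancel (by simp [hr]) (by finiteness), one_mul, mul_right_comm,
    mul_comm]
  gcongr
  set g : Euc n → ℝ := fun u => f (x - r • u)
  have hg : Measurable g := by fun_prop
  have hL : ∫⁻ u in ball (0 : Euc n) 1, ‖Ω (x - (x - r • u)) * f (x - r • u)‖ₑ =
      eLpNorm (Ω • g) 1 μ := by
    rw [eLpNorm_one_eq_lintegral_enorm]
    simp [g, μ, hΩ.2.1 hr]
  have hR : (∫⁻ u in ball (0 : Euc n) 1, ‖f (x - r • u)‖ₑ ^ p) ^ (1 / p) =
      eLpNorm g (ENNReal.ofReal p) μ := by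
    rw [eLpNorm_eq_lintegral_rpow_enorm_toReal (by simp [hp0]) (by simp),
      ENNReal.toReal_ofReal hp0.le]
  rw [hL, hR]
  calc eLpNorm (Ω • g) 1 μ ≤ eLpNorm Ω s μ * eLpNorm g (ENNReal.ofReal t) μ :=
        eLpNorm_smul_le_mul_eLpNorm hg.aestronglyMeasurable hΩm.aestronglyMeasurable
    _ ≤ eLpNorm Ω s μ * (eLpNorm g (ENNReal.ofReal p) μ * μ Set.univ ^ e) := by
        gcongr
        exact eLpNorm_le_eLpNorm_mul_rpow_measure_univ (ENNReal.ofReal_le_ofReal hp)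
          hg.aestronglyMeasurable
    _ = K * eLpNorm g (ENNReal.ofReal p) μ := by simp only [K]; ring

theorem volume_closedBall_euc {n : ℕ} (x : Euc n) {r : ℝ} (hr : 0 ≤ r) :
    volume (closedBall x r) = volume (ball (0 : Euc n) 1) * ENNReal.ofReal r ^ n := by
  rw [Measure.addHaar_closedBall _ _ hr, ENNReal.ofReal_pow hr, mul_comm]
  simp

theorem volume_ball_euc {n : ℕ} (x : Euc n) {r : ℝ} (hr : 0 < r) :
    volume (ball x r) = volume (ball (0 : Euc n) 1) * ENNReal.ofReal r ^ n := by
  rw [Measure.addHaar_ball_of_pos _ _ hr, ENNReal.ofReal_pow hr.le, mul_comm]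
  simp

/-- Localized weak type `(1,1)` estimate for the maximal function of a density satisfying
a Morrey growth condition. -/
theorem measure_le_of_ball_average {n : ℕ} {κ : ℝ} (hκ0 : 0 < κ) (hκ1 : κ < 1) (D : NNReal) :
    ∃ C : NNReal, ∀ Φ : Euc n → ℝ≥0∞,
      (∀ z r, 0 < r → ∫⁻ y in ball z r, Φ y ≤ D * ENNReal.ofReal r ^ (n * κ)) →
      ∀ A : ℝ≥0∞, A ≠ ⊤ → ∀ (z : Euc n) (r : ℝ), 0 < r → ∀ E ⊆ ball z r,
        (∀ x ∈ E, ∃ ρ, 0 < ρ ∧ A * ENNReal.ofReal ρ ^ n ≤ ∫⁻ y in ball x ρ, Φ y) →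
        A * volume E ≤ C * ENNReal.ofReal r ^ (n * κ) := by
  set v : ℝ≥0∞ := volume (ball (0 : Euc n) 1)
  have hv : v ≠ ⊤ := measure_ball_lt_top.ne
  have hnκ : 0 ≤ n * κ := by positivity
  set C : ℝ≥0∞ := v * D + v * 5 ^ n * D * 2 ^ (n * κ)
  have hC : C ≠ ⊤ := by simp only [C]; finiteness
  refine ⟨C.toNNReal, fun Φ hΦ A hA z r hr E hE hρ => ?_⟩
  rw [ENNReal.coe_toNNReal hC]
  choose! ρ hρ0 hρA using hρ
  by_cases hbig : ∃ x ∈ E, r ≤ ρ x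
  · obtain ⟨x, hx, hrx⟩ := hbig
    have h0 := hρ0 x hx
    set τ := ENNReal.ofReal (r / ρ x)
    have hτ1 : τ ≤ 1 := by
      rw [← ENNReal.ofReal_one]
      exact ENNReal.ofReal_le_ofReal ((div_le_one h0).2 hrx)
    have hτr : ENNReal.ofReal r = ENNReal.ofReal (ρ x) * τ := by
      rw [← ENNReal.ofReal_mul h0.le, mul_div_cancel₀ _ h0.ne']
    have hτn : τ ^ n ≤ τ ^ (n * κ) := by
      rw [← ENNReal.rpow_natCast]
      exact ENNReal.rpow_le_rpow_of_exponent_ge hτ1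
        (mul_le_of_le_one_right (by positivity) hκ1.le)
    have hA1 : A * ENNReal.ofReal r ^ n ≤ D * ENNReal.ofReal r ^ (n * κ) := by
      calc A * ENNReal.ofReal r ^ n = (A * ENNReal.ofReal (ρ x) ^ n) * τ ^ n := by
            rw [hτr, mul_pow, mul_assoc]
        _ ≤ (D * ENNReal.ofReal (ρ x) ^ (n * κ)) * τ ^ (n * κ) :=
            mul_le_mul' ((hρA x hx).trans (hΦ x _ h0)) hτn
        _ = D * ENNReal.ofReal r ^ (n * κ) := by
            rw [hτr, ENNReal.mul_rpow_of_nonneg _ _ hnκ, mul_assoc]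
    calc A * volume E ≤ A * (v * ENNReal.ofReal r ^ n) := by
          gcongr; exact (measure_mono hE).trans_eq (volume_ball_euc z hr)
      _ = v * (A * ENNReal.ofReal r ^ n) := by ring
      _ ≤ v * (D * ENNReal.ofReal r ^ (n * κ)) := by gcongr
      _ = v * D * ENNReal.ofReal r ^ (n * κ) := by ring
      _ ≤ C * ENNReal.ofReal r ^ (n * κ) := by gcongr; exact le_self_add
  · push Not at hbig
    obtain ⟨u, huE, hdisj, hcov⟩ := Vitali.exists_disjoint_subfamily_covering_enlargement_closedBall
      E id ρ r (fun a ha => (hbig a ha).le) 5 (by norm_num)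
    have hdisj' : u.PairwiseDisjoint fun a => ball a (ρ a) :=
      hdisj.mono fun a => ball_subset_closedBall
    have hcount : u.Countable := hdisj'.countable_of_isOpen (fun _ _ => isOpen_ball)
      fun a ha => ⟨a, mem_ball_self (hρ0 a (huE ha))⟩
    have hEsub : E ⊆ ⋃ b ∈ u, closedBall b (5 * ρ b) := by
      intro a ha
      obtain ⟨b, hb, hab⟩ := hcov a ha
      exact Set.mem_biUnion hb (hab (mem_closedBall_self (hρ0 a ha).le))
    have hUsub : ⋃ b ∈ u, ball b (ρ b) ⊆ ball z (2 * r) := by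
      refine Set.iUnion₂_subset fun b hb => ball_subset_ball' ?_
      have h1 := hbig b (huE hb)
      have h2 := mem_ball.1 (hE (huE hb))
      linarith
    calc A * volume E ≤ A * ∑' b : u, volume (closedBall b.1 (5 * ρ b)) := by
          gcongr; exact (measure_mono hEsub).trans (measure_biUnion_le _ hcount _)
      _ = ∑' b : u, v * 5 ^ n * (A * ENNReal.ofReal (ρ b) ^ n) := by
          rw [← ENNReal.tsum_mul_left]
          refine tsum_congr fun b => ?_
          rw [volume_closedBall_euc _ (by linarith [hρ0 b (huE b.2)]),
            ENNReal.ofReal_mul (by norm_num), mul_pow]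
          simp only [ENNReal.ofReal_ofNat]
          ring
      _ ≤ ∑' b : u, v * 5 ^ n * ∫⁻ y in ball b.1 (ρ b), Φ y := by
          gcongr with b; exact hρA b (huE b.2)
      _ = v * 5 ^ n * ∫⁻ y in ⋃ b ∈ u, ball b (ρ b), Φ y := by
          rw [ENNReal.tsum_mul_left, lintegral_biUnion hcount (fun _ _ => measurableSet_ball) hdisj']
      _ ≤ v * 5 ^ n * (D * ENNReal.ofReal (2 * r) ^ (n * κ)) := by
          gcongr; exact (lintegral_mono_set hUsub).trans (hΦ z _ (by linarith))
      _ = v * 5 ^ n * D * 2 ^ (n * κ) * ENNReal.ofReal r ^ (n * κ) := by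
          rw [ENNReal.ofReal_mul (by norm_num), ENNReal.mul_rpow_of_nonneg _ _ hnκ]
          simp only [ENNReal.ofReal_ofNat]
          ring
      _ ≤ C * ENNReal.ofReal r ^ (n * κ) := by gcongr; exact le_add_self

/-- Dyadic decomposition of the multilinear fractional integral around a scale `δ`. -/
theorem enorm_multiT_le_tsum {n m : ℕ} {α : ℝ} (hα : α < m * n) {Ω f : Fin m → Euc n → ℝ}
    (hΩ : ∀ i, Measurable (Ω i)) (hf : ∀ i, Measurable (f i)) (x : Euc n) {δ : ℝ} (hδ : 0 < δ) :
    ‖multiT m α Ω f x‖ₑ ≤ ∑' j : ℤ, ENNReal.ofReal ((δ * 2 ^ j / 2) ^ (α - m * n)) *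
      ∏ i, ∫⁻ y in ball x (δ * 2 ^ j), ‖Ω i (x - y) * f i y‖ₑ := by
  have hγ : 0 < m * n - α := by linarith
  refine (enorm_integral_le_lintegral_enorm _).trans ?_
  set G : ℤ → Fin m → Euc n → ℝ≥0∞ := fun j i =>
    (ball x (δ * 2 ^ j)).indicator fun y => ‖Ω i (x - y) * f i y‖ₑ
  have hG : ∀ j i, Measurable (G j i) := fun j i =>
    Measurable.indicator (by fun_prop) measurableSet_ball
  have hpt : ∀ y : Fin m → Euc n, ‖(∏ i, Ω i (x - y i) * f i (y i)) /
      (Real.sqrt (∑ j, ‖x - y j‖ ^ 2)) ^ ((m * n : ℝ) - α)‖ₑ ≤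
      ∑' j : ℤ, ENNReal.ofReal ((δ * 2 ^ j / 2) ^ (α - m * n)) * ∏ i, G j i (y i) := by
    intro y
    set R := Real.sqrt (∑ j, ‖x - y j‖ ^ 2)
    have hR0 : 0 ≤ R := Real.sqrt_nonneg _
    rcases hR0.eq_or_lt with hR | hR
    · rw [← hR, Real.zero_rpow hγ.ne', _root_.div_zero, enorm_zero]
      exact zero_le
    obtain ⟨k, hk1, hk2⟩ := exists_mem_Ico_zpow (div_pos hR hδ) one_lt_two
    rw [le_div_iff₀ hδ] at hk1
    rw [div_lt_iff₀ hδ] at hk2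
    refine le_trans ?_ (ENNReal.le_tsum (k + 1))
    have hball : ∀ i, y i ∈ ball x (δ * 2 ^ (k + 1)) := by
      intro i
      rw [mem_ball, dist_comm, dist_eq_norm]
      have : ‖x - y i‖ ≤ R := by
        apply Real.le_sqrt_of_sq_le
        exact Finset.single_le_sum (f := fun j => ‖x - y j‖ ^ 2) (fun j _ => by positivity)
          (Finset.mem_univ i)
      linarith
    have hGy : ∀ i, G (k + 1) i (y i) = ‖Ω i (x - y i) * f i (y i)‖ₑ := fun i =>
      Set.indicator_of_mem (hball i) _
    simp only [hGy]
    rw [div_eq_mul_inv, ← Real.rpow_neg hR.le, neg_sub, enorm_mul, mul_comm]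
    simp_rw [enorm_eq_nnnorm, nnnorm_prod, ENNReal.ofNNReal_finsetProd, ← enorm_eq_nnnorm]
    gcongr
    rw [Real.enorm_of_nonneg (by positivity)]
    apply ENNReal.ofReal_le_ofReal
    apply Real.rpow_le_rpow_of_nonpos (by positivity) _ (by linarith)
    rw [zpow_add_one₀ two_ne_zero]
    linarith
  refine (lintegral_mono hpt).trans_eq ?_
  rw [lintegral_tsum fun j => (Measurable.aemeasurable (by fun_prop))]
  refine tsum_congr fun j => ?_
  rw [lintegral_const_mul _ (by fun_prop), lintegral_fin_prod _ _ (hG j)]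
  simp only [G, lintegral_indicator measurableSet_ball]

/-- At the scale `A ^ (-1 / N)` the two competing bounds balance and decay geometrically. -/
theorem dyadic_rpow_mul_min_le {α N P A D : ℝ} (hN : 0 < N) (hP : 0 < P)
    (hA : 0 < A) (hD : 0 ≤ D) (j : ℤ) :
    (A ^ (-1 / N) * 2 ^ j) ^ α * (min A (D * (A ^ (-1 / N) * 2 ^ j) ^ (-N))) ^ (1 / P) ≤
      (max 1 D) ^ (1 / P) * A ^ (1 / P - α / N) * 2 ^ (-(min α (N / P - α)) * |(j : ℝ)|) := by
  set M := max 1 D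
  have hM : 0 < M := lt_max_of_lt_left one_pos
  rw [← Real.rpow_intCast]
  have hbase : ∀ e : ℝ, (A ^ (-1 / N) * (2 : ℝ) ^ (j : ℝ)) ^ e =
      A ^ (-e / N) * 2 ^ (j * e) := by
    intro e
    rw [Real.mul_rpow (by positivity) (by positivity), ← Real.rpow_mul hA.le,
      ← Real.rpow_mul (by norm_num)]
    congr 2; ring
  have hX0 : 0 ≤ min A (D * (A ^ (-1 / N) * (2 : ℝ) ^ (j : ℝ)) ^ (-N)) := by positivity
  have key : ∀ θ : ℝ, min A (D * (A ^ (-1 / N) * (2 : ℝ) ^ (j : ℝ)) ^ (-N)) ≤ M * A * 2 ^ (-θ) →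
      j * α - θ / P ≤ -(min α (N / P - α)) * |(j : ℝ)| →
      (A ^ (-1 / N) * (2 : ℝ) ^ (j : ℝ)) ^ α *
        (min A (D * (A ^ (-1 / N) * (2 : ℝ) ^ (j : ℝ)) ^ (-N))) ^ (1 / P) ≤
      M ^ (1 / P) * A ^ (1 / P - α / N) * 2 ^ (-(min α (N / P - α)) * |(j : ℝ)|) := by
    intro θ h1 h2
    calc _ ≤ (A ^ (-α / N) * 2 ^ (j * α)) * (M * A * 2 ^ (-θ)) ^ (1 / P) := by
          rw [hbase α]; gcongr
      _ = M ^ (1 / P) * A ^ (1 / P - α / N) * 2 ^ (j * α - θ / P) := by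
          rw [Real.mul_rpow (by positivity) (by positivity), Real.mul_rpow hM.le hA.le,
            ← Real.rpow_mul (by norm_num), sub_eq_add_neg (1 / P), sub_eq_add_neg (j * α),
            Real.rpow_add hA, Real.rpow_add two_pos, show -α / N = -(α / N) by ring,
            show -θ * (1 / P) = -(θ / P) by ring]
          ring
      _ ≤ _ := by
          gcongr
          norm_num
  rcases le_total (j : ℝ) 0 with hj | hj
  · refine key 0 ?_ ?_
    · rw [neg_zero, Real.rpow_zero, mul_one]
      exact (min_le_left _ _).trans (le_mul_of_one_le_left hA.le (le_max_left _ _))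
    · rw [abs_of_nonpos hj, _root_.zero_div, sub_zero]
      nlinarith [min_le_left α (N / P - α)]
  · refine key (j * N) ?_ ?_
    · refine (min_le_right _ _).trans ?_
      rw [hbase, neg_neg, div_self hN.ne', Real.rpow_one, mul_neg, ← mul_assoc]
      gcongr
      exact le_max_right _ _
    · rw [abs_of_nonneg hj]
      have : (j : ℝ) * N / P = j * (N / P) := by ring
      nlinarith [min_le_right α (N / P - α)]

theorem summable_two_rpow_neg_mul_abs {ε : ℝ} (hε : 0 < ε) :
    Summable fun j : ℤ => (2 : ℝ) ^ (-ε * |(j : ℝ)|) := by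
  have h : Summable fun k : ℕ => ((2 : ℝ) ^ (-ε)) ^ k :=
    summable_geometric_of_lt_one (by positivity)
      (Real.rpow_lt_one_of_one_lt_of_neg one_lt_two (by linarith))
  have h' : Summable fun k : ℕ => (2 : ℝ) ^ (-ε * (k : ℝ)) := by
    refine h.congr fun k => ?_
    rw [Real.rpow_mul (by norm_num), Real.rpow_natCast]
  refine Summable.of_nat_of_neg ?_ ?_ <;> simpa using h'

/-- Hedberg-type estimate: the operator is controlled by a bound `A` for the averages of a
common majorant `Φ`, together with its Morrey growth. -/
theorem enorm_multiT_le_of_average_le {n m : ℕ} (hn : 2 ≤ n) {α : ℝ} (hα : 0 < α)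
    (hαmn : α < m * n) {s : ℝ≥0∞} (hs : 1 < s) {Ω : Fin m → Euc n → ℝ}
    (hΩ : ∀ i, MemSphereLp n s (Ω i)) {p : Fin m → ℝ} {P N : ℝ} (hP0 : 0 < P) (hN : 0 < N)
    (hpi : ∀ i, conjExp s ≤ p i) (hP : 1 / P = ∑ i, 1 / p i) (hαN : α < N / P) (D : NNReal) :
    ∃ K : NNReal, ∀ f : Fin m → Euc n → ℝ, (∀ i, Measurable (f i)) →
      ∀ (F : Fin m → NNReal) (Φ : Euc n → ℝ≥0∞),
      (∀ i y, ‖f i y‖ₑ ^ p i ≤ (F i : ℝ≥0∞) ^ p i * Φ y) → ∀ (x : Euc n) (A : ℝ), 0 < A →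
      (∀ ρ, 0 < ρ → ∫⁻ y in ball x ρ, Φ y ≤ ENNReal.ofReal ρ ^ n * ENNReal.ofReal A) →
      (∀ ρ, 0 < ρ → ∫⁻ y in ball x ρ, Φ y ≤
        ENNReal.ofReal ρ ^ n * (D * ENNReal.ofReal (ρ ^ (-N)))) →
      ‖multiT m α Ω f x‖ₑ ≤ K * ENNReal.ofReal (A ^ (1 / P - α / N)) * ∏ i, (F i : ℝ≥0∞) := by
  have hp0 : ∀ i, 0 < p i := fun i => by linarith [(conjExp_holder hs).1, hpi i]
  choose K hK using fun i => lintegral_ball_kernel_mul_le hn hs (hΩ i) (hpi i)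
  set ε := min α (N / P - α)
  have hε : 0 < ε := lt_min hα (by linarith)
  set S : ℝ≥0∞ := ∑' j : ℤ, ENNReal.ofReal (2 ^ (-ε * |(j : ℝ)|))
  have hS : S ≠ ⊤ := (summable_two_rpow_neg_mul_abs hε).tsum_ofReal_ne_top
  set C : ℝ≥0∞ := (∏ i, (K i : ℝ≥0∞)) * ENNReal.ofReal (2 ^ (m * n - α)) *
    ENNReal.ofReal ((max 1 D : ℝ) ^ (1 / P)) * S
  have hC : C ≠ ⊤ := by
    simp only [C, ← ENNReal.ofNNReal_finsetProd]
    finiteness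
  refine ⟨C.toNNReal, fun f hf F Φ hΦ x A hA h1 h2 => ?_⟩
  rw [ENNReal.coe_toNNReal hC]
  set δ : ℝ := A ^ (-1 / N)
  have hδ : 0 < δ := by positivity
  refine (enorm_multiT_le_tsum hαmn (fun i => (hΩ i).1) hf x hδ).trans ?_
  have hterm : ∀ j : ℤ, ENNReal.ofReal ((δ * 2 ^ j / 2) ^ (α - m * n)) *
      ∏ i, ∫⁻ y in ball x (δ * 2 ^ j), ‖Ω i (x - y) * f i y‖ₑ ≤
      (∏ i, (K i : ℝ≥0∞)) * ENNReal.ofReal (2 ^ (m * n - α)) * (∏ i, (F i : ℝ≥0∞)) *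
        (ENNReal.ofReal ((max 1 D : ℝ) ^ (1 / P)) * ENNReal.ofReal (A ^ (1 / P - α / N)) *
        ENNReal.ofReal (2 ^ (-ε * |(j : ℝ)|))) := by
    intro j
    set ρ : ℝ := δ * 2 ^ j
    have hρ : 0 < ρ := by positivity
    set Q : ℝ := min A (D * ρ ^ (-N))
    have hQ : 0 ≤ Q := by positivity
    have ha : (ENNReal.ofReal ρ ^ n)⁻¹ * ∫⁻ y in ball x ρ, Φ y ≤ ENNReal.ofReal Q := by
      rw [mul_comm, ← div_eq_mul_inv]
      refine ENNReal.div_le_of_le_mul' ?_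
      rw [ENNReal.ofReal_min, ENNReal.ofReal_mul D.coe_nonneg, ENNReal.ofReal_coe_nnreal]
      rcases min_choice (ENNReal.ofReal A) (D * ENNReal.ofReal (ρ ^ (-N))) with h | h <;> rw [h]
      exacts [h1 ρ hρ, h2 ρ hρ]
    have hi : ∀ i, ∫⁻ y in ball x ρ, ‖Ω i (x - y) * f i y‖ₑ ≤
        K i * ENNReal.ofReal ρ ^ n * (F i * ENNReal.ofReal Q ^ (1 / p i)) := by
      intro i
      refine (hK i (f i) (hf i) x ρ hρ).trans ?_
      gcongr
      have hFp : (F i : ℝ≥0∞) ^ p i ≠ ⊤ := by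
        have := hp0 i
        finiteness
      calc ((ENNReal.ofReal ρ ^ n)⁻¹ * ∫⁻ y in ball x ρ, ‖f i y‖ₑ ^ p i) ^ (1 / p i)
          ≤ ((F i : ℝ≥0∞) ^ p i * ENNReal.ofReal Q) ^ (1 / p i) := by
            refine ENNReal.rpow_le_rpow ?_ (one_div_nonneg.2 (hp0 i).le)
            calc _ ≤ (ENNReal.ofReal ρ ^ n)⁻¹ * ∫⁻ y in ball x ρ, (F i : ℝ≥0∞) ^ p i * Φ y := by
                  gcongr with y; exact hΦ i y
              _ = (F i : ℝ≥0∞) ^ p i * ((ENNReal.ofReal ρ ^ n)⁻¹ * ∫⁻ y in ball x ρ, Φ y) := by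
                  rw [lintegral_const_mul' _ _ hFp]; ring
              _ ≤ _ := by gcongr
        _ = F i * ENNReal.ofReal Q ^ (1 / p i) := by
            rw [ENNReal.mul_rpow_of_nonneg _ _ (one_div_nonneg.2 (hp0 i).le), ← ENNReal.rpow_mul,
              mul_one_div_cancel (hp0 i).ne', ENNReal.rpow_one]
    have hQprod : ∏ i, ENNReal.ofReal Q ^ (1 / p i) = ENNReal.ofReal (Q ^ (1 / P)) := by
      rw [hP, Real.rpow_sum_of_nonneg hQ fun i _ => one_div_nonneg.2 (hp0 i).le,
        ENNReal.ofReal_prod_of_nonneg fun i _ => by positivity]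
      exact Finset.prod_congr rfl fun i _ =>
        ENNReal.ofReal_rpow_of_nonneg hQ (one_div_nonneg.2 (hp0 i).le)
    have hpow : ENNReal.ofReal ((ρ / 2) ^ (α - m * n)) * (ENNReal.ofReal ρ ^ n) ^ m =
        ENNReal.ofReal (2 ^ (m * n - α)) * ENNReal.ofReal (ρ ^ α) := by
      rw [← pow_mul, ← ENNReal.ofReal_pow hρ.le, ← ENNReal.ofReal_mul (by positivity),
        ← ENNReal.ofReal_mul (by positivity), Real.div_rpow hρ.le (by norm_num),
        Real.rpow_sub hρ, Real.rpow_sub two_pos, Real.rpow_sub two_pos, mul_comm (m : ℝ),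
        ← Nat.cast_mul, Real.rpow_natCast, Real.rpow_natCast]
      congr 1
      field_simp
    calc _ ≤ ENNReal.ofReal ((ρ / 2) ^ (α - m * n)) *
          ∏ i, (K i * ENNReal.ofReal ρ ^ n * (F i * ENNReal.ofReal Q ^ (1 / p i))) := by
          gcongr with i; exact hi i
      _ = (∏ i, (K i : ℝ≥0∞)) * (∏ i, (F i : ℝ≥0∞)) *
          (ENNReal.ofReal ((ρ / 2) ^ (α - m * n)) * (ENNReal.ofReal ρ ^ n) ^ m) *
            ENNReal.ofReal (Q ^ (1 / P)) := by
          simp only [Finset.prod_mul_distrib, hQprod, Finset.prod_const, Finset.card_univ,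
            Fintype.card_fin]
          ring
      _ = (∏ i, (K i : ℝ≥0∞)) * ENNReal.ofReal (2 ^ (m * n - α)) * (∏ i, (F i : ℝ≥0∞)) *
          ENNReal.ofReal (ρ ^ α * Q ^ (1 / P)) := by
          rw [hpow, ENNReal.ofReal_mul (by positivity)]
          ring
      _ ≤ _ := by
          rw [← ENNReal.ofReal_mul (by positivity), ← ENNReal.ofReal_mul (by positivity)]
          refine mul_le_mul_right (ENNReal.ofReal_le_ofReal ?_) _
          exact dyadic_rpow_mul_min_le hN hP0 hA D.coe_nonneg j
  refine (ENNReal.tsum_le_tsum hterm).trans_eq ?_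
  rw [ENNReal.tsum_mul_left, ENNReal.tsum_mul_left]
  simp only [C, S]
  ring

theorem lintegral_ball_le_of_morreyNorm_le {n : ℕ} {p κ : ℝ} (hp : 0 < p) {f : Euc n → ℝ}
    {F : ℝ≥0∞} (hF : morreyNorm p κ f ≤ F) (z : Euc n) {r : ℝ} (hr : 0 < r) :
    ∫⁻ y in ball z r, ‖f y‖ₑ ^ p ≤ volume (ball z r) ^ κ * F ^ p := by
  have h := (le_iSup_of_le z (le_iSup_of_le (⟨r, hr⟩ : Set.Ioi (0 : ℝ)) le_rfl)).trans hF
  have hv0 : volume (ball z r) ≠ 0 := (measure_ball_pos _ _ hr).ne'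
  have hvt : volume (ball z r) ≠ ⊤ := measure_ball_lt_top.ne
  simp only [← Real.enorm_eq_ofReal_abs] at h
  rw [one_div, ENNReal.rpow_inv_le_iff hp] at h
  calc ∫⁻ y in ball z r, ‖f y‖ₑ ^ p
      = volume (ball z r) ^ κ *
        (volume (ball z r) ^ (-κ) * ∫⁻ y in ball z r, ‖f y‖ₑ ^ p) := by
        rw [← mul_assoc, ← ENNReal.rpow_add _ _ hv0 hvt, add_neg_cancel, ENNReal.rpow_zero,
          one_mul]
    _ ≤ _ := by gcongr

/-- The weak type estimate in terms of positive upper bounds for the Morrey norms. -/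
theorem weakMorreyNorm_multiT_le_of_pos {n m : ℕ} (hn : 2 ≤ n) {α : ℝ} (hα : 0 < α)
    (hαmn : α < m * n) {s : ℝ≥0∞} (hs : 1 < s) {Ω : Fin m → Euc n → ℝ}
    (hΩ : ∀ i, MemSphereLp n s (Ω i)) {p : Fin m → ℝ} {P q κ : ℝ} (hP0 : 0 < P) (hq0 : 0 < q)
    (hpi : ∀ i, conjExp s ≤ p i) (hP : 1 / P = ∑ i, 1 / p i) (hκ0 : 0 < κ) (hκ1 : κ < 1)
    (hακ : α < n * (1 - κ) / P) (hq : 1 / q = 1 / P - α / (n * (1 - κ))) :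
    ∃ C : NNReal, ∀ f : Fin m → Euc n → ℝ, (∀ i, Measurable (f i)) →
      ∀ F : Fin m → NNReal, (∀ i, 0 < F i) → (∀ i, morreyNorm (p i) κ (f i) ≤ F i) →
      weakMorreyNorm q κ (multiT m α Ω f) ≤ C * ∏ i, (F i : ℝ≥0∞) := by
  have hp0 : ∀ i, 0 < p i := fun i => by linarith [(conjExp_holder hs).1, hpi i]
  have hn0 : (0 : ℝ) < n := by exact_mod_cast (by omega : 0 < n)
  set N : ℝ := n * (1 - κ)
  have hN : 0 < N := mul_pos hn0 (by linarith)
  set v : ℝ≥0∞ := volume (ball (0 : Euc n) 1)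
  have hv : v ≠ ⊤ := measure_ball_lt_top.ne
  have hv0 : v ≠ 0 := (measure_ball_pos _ _ one_pos).ne'
  have hD : m * v ^ κ ≠ ⊤ := by finiteness
  set D : NNReal := (m * v ^ κ).toNNReal
  obtain ⟨K, hK⟩ := enorm_multiT_le_of_average_le hn hα hαmn hs hΩ hP0 hN hpi hP hακ D
  obtain ⟨M, hM⟩ := measure_le_of_ball_average (n := n) hκ0 hκ1 D
  set C : ℝ≥0∞ := (K + 1) * (v ^ (-(κ / q)) * M ^ (1 / q))
  have hC : C ≠ ⊤ := by
    have := one_div_pos.2 hq0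
    have h1 : v ^ (-(κ / q)) ≠ ⊤ := ENNReal.rpow_ne_top_of_ne_zero hv0 hv
    simp only [C]
    finiteness
  refine ⟨C.toNNReal, fun f hf F hF hmor => ?_⟩
  rw [ENNReal.coe_toNNReal hC]
  have hFp : ∀ i, (F i : ℝ≥0∞) ^ p i ≠ 0 ∧ (F i : ℝ≥0∞) ^ p i ≠ ⊤ := fun i => by
    have h1 := hp0 i
    have h2 : (F i : ℝ≥0∞) ≠ 0 := by simpa using (hF i).ne'
    exact ⟨by simp [h1, h2], by finiteness⟩
  set Φ : Euc n → ℝ≥0∞ := fun y => ∑ i, ((F i : ℝ≥0∞) ^ p i)⁻¹ * ‖f i y‖ₑ ^ p i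
  have hfΦ : ∀ i y, ‖f i y‖ₑ ^ p i ≤ (F i : ℝ≥0∞) ^ p i * Φ y := by
    intro i y
    calc ‖f i y‖ₑ ^ p i
        = (F i : ℝ≥0∞) ^ p i * (((F i : ℝ≥0∞) ^ p i)⁻¹ * ‖f i y‖ₑ ^ p i) := by
          rw [← mul_assoc, ENNReal.mul_inv_cancel (hFp i).1 (hFp i).2, one_mul]
      _ ≤ _ := by
          gcongr
          exact Finset.single_le_sum (f := fun i => ((F i : ℝ≥0∞) ^ p i)⁻¹ * ‖f i y‖ₑ ^ p i)
            (fun _ _ => zero_le) (Finset.mem_univ i)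
  have hΦ : ∀ (z : Euc n) (r : ℝ), 0 < r →
      ∫⁻ y in ball z r, Φ y ≤ D * ENNReal.ofReal r ^ (n * κ) := by
    intro z r hr
    rw [lintegral_finsetSum _ fun i _ => by fun_prop]
    calc _ ≤ ∑ i : Fin m, volume (ball z r) ^ κ := by
          refine Finset.sum_le_sum fun i _ => ?_
          rw [lintegral_const_mul' _ _ (ENNReal.inv_ne_top.2 (hFp i).1), mul_comm,
            ← div_eq_mul_inv]
          refine ENNReal.div_le_of_le_mul ?_
          exact lintegral_ball_le_of_morreyNorm_le (hp0 i) (hmor i) z hr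
      _ = D * ENNReal.ofReal r ^ (n * κ) := by
          rw [ENNReal.coe_toNNReal hD, volume_ball_euc z hr, ENNReal.mul_rpow_of_nonneg _ _ hκ0.le,
            ENNReal.rpow_mul, ENNReal.rpow_natCast]
          simp [mul_assoc, v]
  have hΦ' : ∀ (z : Euc n) (r : ℝ), 0 < r →
      ∫⁻ y in ball z r, Φ y ≤ ENNReal.ofReal r ^ n * (D * ENNReal.ofReal (r ^ (-N))) := by
    intro z r hr
    refine (hΦ z r hr).trans_eq ?_
    rw [mul_left_comm, ← ENNReal.ofReal_pow hr.le, ← ENNReal.ofReal_mul (by positivity),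
      ← Real.rpow_natCast, ← Real.rpow_add hr, ENNReal.ofReal_rpow_of_pos hr]
    congr 3
    simp only [N]; ring
  set G : NNReal := (K + 1) * ∏ i, F i
  have hG : 0 < G := by
    have := Finset.prod_pos fun i (_ : i ∈ Finset.univ) => hF i
    positivity
  refine iSup_le fun z => iSup_le fun ⟨r, hr⟩ => iSup_le fun ⟨l, hl⟩ => ?_
  rw [Set.mem_Ioi] at hr hl
  simp only
  set A : ℝ := (l / G) ^ q
  have hG' : (0 : ℝ) < G := by exact_mod_cast hG
  have hA : 0 < A := by positivity
  have hAq : A ^ (1 / q) = l / G := by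
    rw [← Real.rpow_mul (by positivity), mul_one_div_cancel hq0.ne', Real.rpow_one]
  have hGl : ENNReal.ofReal l = G * ENNReal.ofReal A ^ (1 / q) := by
    rw [ENNReal.ofReal_rpow_of_pos hA, hAq, ← ENNReal.ofReal_coe_nnreal,
      ← ENNReal.ofReal_mul hG'.le, mul_div_cancel₀ _ hG'.ne']
  set E : Set (Euc n) :=
    {y | y ∈ ball z r ∧ ENNReal.ofReal l < ENNReal.ofReal |multiT m α Ω f y|}
  have hE := hM Φ hΦ (ENNReal.ofReal A) ENNReal.ofReal_ne_top z r hr E (fun y hy => hy.1) <| by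
    intro y hy
    by_contra! hcon
    have h := hK f hf F Φ hfΦ y A hA
      (fun ρ hρ => (hcon ρ hρ).le.trans_eq (mul_comm _ _)) (hΦ' y)
    rw [← hq, ← ENNReal.ofReal_rpow_of_pos hA, Real.enorm_eq_ofReal_abs] at h
    refine (hy.2.trans_le h).not_ge ?_
    rw [hGl]
    simp only [G, ENNReal.coe_mul, ENNReal.coe_add, ENNReal.coe_one, ENNReal.ofNNReal_finsetProd]
    rw [mul_right_comm]
    gcongr
    exact le_self_add
  set X : ℝ≥0∞ := ENNReal.ofReal r ^ (n * κ / q)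
  have hr0 : ENNReal.ofReal r ≠ 0 := by simpa using hr
  have hX0 : X ≠ 0 := (ENNReal.rpow_pos (pos_iff_ne_zero.2 hr0) ENNReal.ofReal_ne_top).ne'
  have hXt : X ≠ ⊤ := ENNReal.rpow_ne_top_of_ne_zero hr0 ENNReal.ofReal_ne_top
  have hball : volume (ball z r) ^ (-(κ / q)) = v ^ (-(κ / q)) * X⁻¹ := by
    rw [volume_ball_euc z hr, ENNReal.mul_rpow_of_ne_top hv (by finiteness),
      ← ENNReal.rpow_natCast, ← ENNReal.rpow_mul, ← ENNReal.rpow_neg]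
    congr 2; ring
  have h1q : 0 ≤ 1 / q := (one_div_pos.2 hq0).le
  calc volume (ball z r) ^ (-(κ / q)) * ENNReal.ofReal l * volume E ^ (1 / q)
      = v ^ (-(κ / q)) * X⁻¹ * G * (ENNReal.ofReal A * volume E) ^ (1 / q) := by
        rw [hball, hGl, ENNReal.mul_rpow_of_nonneg _ _ h1q]; ring
    _ ≤ v ^ (-(κ / q)) * X⁻¹ * G * (M * ENNReal.ofReal r ^ (n * κ)) ^ (1 / q) := by gcongr
    _ = v ^ (-(κ / q)) * G * M ^ (1 / q) * (X⁻¹ * X) := by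
        rw [ENNReal.mul_rpow_of_nonneg _ _ h1q, ← ENNReal.rpow_mul, mul_one_div]; ring
    _ = C * ∏ i, (F i : ℝ≥0∞) := by
        rw [ENNReal.inv_mul_cancel hX0 hXt]
        simp only [C, G, ENNReal.coe_mul, ENNReal.coe_add, ENNReal.coe_one,
          ENNReal.ofNNReal_finsetProd]
        ring

/-- Weak type boundedness of the multilinear fractional integral operator with homogeneous
kernels on Morrey spaces when `s' = min p_i`. -/
theorem stmt11
    (n m : ℕ) (hn : 2 ≤ n) (hm : 1 ≤ m) (α : ℝ) (hα : 0 < α) (hαmn : α < m * n)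
    (s : ℝ≥0∞) (hs : 1 < s) (Ω : Fin m → Euc n → ℝ) (hΩ : ∀ i, MemSphereLp n s (Ω i))
    (p : Fin m → ℝ) (P q κ : ℝ)
    (hpi : ∀ i, conjExp s ≤ p i) (hmin : ∃ i, p i = conjExp s)
    (hP : 1 / P = ∑ i, 1 / p i)
    (hPlow : conjExp s / m ≤ P) (hPhigh : P < n / α)
    (hκ0 : 0 < κ) (hκ1 : κ < 1 - α * P / n)
    (hq : 1 / q = 1 / P - α / (n * (1 - κ))) :
    ∃ C : ℝ, 0 < C ∧ ∀ f : Fin m → Euc n → ℝ,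
      (∀ i, Measurable (f i)) → (∀ i, morreyNorm (p i) κ (f i) < ⊤) →
      weakMorreyNorm q κ (multiT m α Ω f) ≤
        ENNReal.ofReal C * ∏ i, morreyNorm (p i) κ (f i) := by
  have hn0 : (0 : ℝ) < n := by exact_mod_cast (by omega : 0 < n)
  have hp0 : ∀ i, 0 < p i := fun i => by linarith [(conjExp_holder hs).1, hpi i]
  obtain ⟨i₀, -⟩ := hmin
  have hP0 : 0 < P := by
    rw [← one_div_pos, hP]
    exact Finset.sum_pos (fun i _ => one_div_pos.2 (hp0 i)) ⟨i₀, Finset.mem_univ _⟩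
  have hκ1' : κ < 1 := hκ1.trans (by linarith [show 0 < α * P / n by positivity])
  have hN : 0 < n * (1 - κ) := mul_pos hn0 (by linarith)
  have hακ : α < n * (1 - κ) / P := by
    rw [lt_div_iff₀ hP0]
    rw [lt_sub_comm, div_lt_iff₀ hn0] at hκ1
    linarith
  have hq0 : 0 < q := by
    rw [← one_div_pos, hq, sub_pos, div_lt_div_iff₀ hN hP0, one_mul]
    exact (lt_div_iff₀ hP0).1 hακ
  obtain ⟨C, hC⟩ :=
    weakMorreyNorm_multiT_le_of_pos hn hα hαmn hs hΩ hP0 hq0 hpi hP hκ0 hκ1' hακ hq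
  refine ⟨C + 1, by positivity, fun f hf hfin => ?_⟩
  set F : Fin m → NNReal := fun i => (morreyNorm (p i) κ (f i)).toNNReal
  have hF : ∀ i, (F i : ℝ≥0∞) = morreyNorm (p i) κ (f i) := fun i =>
    ENNReal.coe_toNNReal (hfin i).ne
  have hlim : Filter.Tendsto (fun ε : NNReal => ((C * ∏ i, (F i + ε) : NNReal) : ℝ≥0∞))
      (nhdsWithin 0 (Set.Ioi 0)) (nhds ((C * ∏ i, F i : NNReal) : ℝ≥0∞)) := by
    refine ENNReal.tendsto_coe.2 (Filter.Tendsto.mono_left ?_ nhdsWithin_le_nhds)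
    exact (by fun_prop : Continuous fun ε : NNReal => C * ∏ i, (F i + ε)).tendsto' _ _ (by simp)
  have hle : weakMorreyNorm q κ (multiT m α Ω f) ≤ ((C * ∏ i, F i : NNReal) : ℝ≥0∞) := by
    refine ge_of_tendsto hlim ?_
    filter_upwards [self_mem_nhdsWithin] with ε hε
    refine (hC f hf (fun i => F i + ε) (fun i => add_pos_of_nonneg_of_pos zero_le hε)
      fun i => ?_).trans_eq (by push_cast; rfl)
    rw [← hF i]
    exact_mod_cast le_self_add
  refine hle.trans ?_
  simp only [← hF]
  rw [ENNReal.coe_mul, ENNReal.ofNNReal_finsetProd, ← ENNReal.ofReal_coe_nnreal]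
  gcongr
  linarith

end
end
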